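/- arXiv:math/0501420 — 4 statements merged into one kernel-verified Lean document; each statement's English description precedes it below -/
import Mathlib

section
/- Let ψ be a reduced admissible function on an alphabet A, and w_ψ the associated infinite word. Then w_ψ is periodic (there exists d ≥ 1 with w_ψ(n+d) = w_ψ(n) for all n) if and only if there exists N such that ψ(n) = n − 1 for every n ≥ N. -/
open Filter

/-- The prefix of length `n` of the infinite word `w`. -/
def pref {A : Type*} (w : ℕ → A) (n : ℕ) : List A := (List.range n).map w

/-- The predicate "the prefix of `w` of length `n` is a palindrome". -/
def palP {A : Type*} (w : ℕ → A) : ℕ → Prop := fun n => (pref w n).Palindrome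

/-- An admissible function: index `i : ℕ` stands for the paper's index `i + 1`, and the
value `Sum.inr j` stands for the paper's integer value `j + 1`; so the paper's condition
`1 ≤ ψ(n) ≤ n - 1` becomes `j < i`. -/
def Admissible {A : Type*} (ψ : ℕ → A ⊕ ℕ) : Prop :=
  ∀ i j, ψ i = Sum.inr j → j < i

/-- The set `S(ψ)` of indices `n` with `ψ(n) ∈ A` or `ψ(n) ≤ n - 2` (in the paper's
indexing; here `i` stands for `n = i + 1` and `Sum.inr j` for the value `j + 1`). -/
def Sset {A : Type*} (ψ : ℕ → A ⊕ ℕ) : Set ℕ :=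
  {i | (∃ a, ψ i = Sum.inl a) ∨ ∃ j, ψ i = Sum.inr j ∧ j + 2 ≤ i}

/-- `m < n` are consecutive elements of `S`. -/
def ConsecIn (S : Set ℕ) (m n : ℕ) : Prop :=
  m ∈ S ∧ n ∈ S ∧ m < n ∧ ∀ k ∈ S, ¬(m < k ∧ k < n)

/-- `ψ` is reduced: for consecutive `m < n` in `S(ψ)`, `ψ(n) ≠ ψ(m)` and either
`ψ(n) ∈ A` or `ψ(n) < m` (in the paper's indexing: `Sum.inr j` stands for the value
`j + 1` and `m` for the index `m + 1`, so the paper's `ψ(n) < m` becomes `j < m`). -/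
def Reduced {A : Type*} (ψ : ℕ → A ⊕ ℕ) : Prop :=
  ∀ m n, ConsecIn (Sset ψ) m n →
    ψ n ≠ ψ m ∧ ((∃ a, ψ n = Sum.inl a) ∨ ∃ j, ψ n = Sum.inr j ∧ j < m)

/-- The palindromes `π_i` associated with `ψ` (`piW ψ i` is the paper's `π_{i+1}`):
`π_1 = ε`; `π_{i+1} = π_i a π_i` if `ψ(i) = a ∈ A`, and `π_{i+1} = π_i u` where `u` is
`π_i` with its first `|π_j|` letters deleted if `ψ(i) = j ∈ ℕ*`. (The `min j i` is
irrelevant when `ψ` is admissible, since then `j < i`.) -/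
def piW {A : Type*} (ψ : ℕ → A ⊕ ℕ) : ℕ → List A
  | 0 => []
  | (i + 1) =>
    match ψ i with
    | Sum.inl a => piW ψ i ++ a :: piW ψ i
    | Sum.inr j => piW ψ i ++ (piW ψ i).drop (piW ψ (min j i)).length

/-- The sequence `(n_i)` associated with `ψ` (`nseq ψ i` is the paper's `n_{i+1}`). -/
def nseq {A : Type*} (ψ : ℕ → A ⊕ ℕ) : ℕ → ℕ
  | 0 => 0
  | (i + 1) =>
    match ψ i with
    | Sum.inl _ => 2 * nseq ψ i + 1
    | Sum.inr j => 2 * nseq ψ i - nseq ψ (min j i)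

/-- `δ(ψ) = limsup n_{i+1} / n_i`. -/
noncomputable def deltaPsi {A : Type*} (ψ : ℕ → A ⊕ ℕ) : ENNReal :=
  limsup (fun i => (nseq ψ (i + 1) : ENNReal) / (nseq ψ i : ENNReal)) atTop

section helpers

variable {A : Type*} {ψ : ℕ → A ⊕ ℕ} {w : ℕ → A}

def nl (ψ : ℕ → A ⊕ ℕ) (i : ℕ) : ℕ := (piW ψ i).length

theorem piW_get (hw : ∀ i, pref w (piW ψ i).length = piW ψ i) (i m : ℕ) (hm : m < nl ψ i) :
    (piW ψ i)[m]? = some (w m) := by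
  rw [← hw i, pref]
  have : m < (piW ψ i).length := hm
  simp [this]

theorem h_inl (hw : ∀ i, pref w (piW ψ i).length = piW ψ i) {i : ℕ} {a : A}
    (h : ψ i = Sum.inl a) :
    nl ψ (i+1) = 2 * nl ψ i + 1 ∧ w (nl ψ i) = a ∧ ∀ m < nl ψ i, w (nl ψ i + 1 + m) = w m := by
  have e : piW ψ (i+1) = piW ψ i ++ a :: piW ψ i := by
    rw [piW, h]
  have hl : nl ψ (i+1) = 2 * nl ψ i + 1 := by
    simp only [nl, e, List.length_append, List.length_cons]; omega
  refine ⟨hl, ?_, ?_⟩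
  · have := piW_get hw (i+1) (nl ψ i) (by omega)
    rw [e, List.getElem?_append_right (by simp [nl])] at this
    simp [nl] at this
    exact this.symm
  · intro m hm
    have := piW_get hw (i+1) (nl ψ i + 1 + m) (by omega)
    rw [e, List.getElem?_append_right (by simp only [nl]; omega)] at this
    have e2 : nl ψ i + 1 + m - (piW ψ i).length = m + 1 := by simp only [nl]; omega
    rw [e2, List.getElem?_cons_succ, piW_get hw i m hm] at this
    exact (Option.some.inj this).symm

theorem h_inr (hw : ∀ i, pref w (piW ψ i).length = piW ψ i) {i j : ℕ} (hji : j < i)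
    (h : ψ i = Sum.inr j) :
    nl ψ (i+1) = nl ψ i + (nl ψ i - nl ψ j) ∧
      ∀ m < nl ψ i - nl ψ j, w (nl ψ i + m) = w (nl ψ j + m) := by
  have e : piW ψ (i+1) = piW ψ i ++ (piW ψ i).drop (nl ψ j) := by
    rw [piW, h]
    simp only [nl, min_eq_left hji.le]
  have hl : nl ψ (i+1) = nl ψ i + (nl ψ i - nl ψ j) := by
    rw [nl, e]; simp [nl]
  refine ⟨hl, ?_⟩
  intro m hm
  have := piW_get hw (i+1) (nl ψ i + m) (by omega)
  rw [e, List.getElem?_append_right (by simp only [nl]; omega)] at this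
  have e2 : nl ψ i + m - (piW ψ i).length = m := by simp only [nl]; omega
  rw [e2, List.getElem?_drop, piW_get hw i _ (by omega)] at this
  exact (Option.some.inj this).symm

theorem nl_strict (hadm : Admissible ψ) (hw : ∀ i, pref w (piW ψ i).length = piW ψ i) :
    StrictMono (nl ψ) := by
  have key : ∀ i, ∀ j < i, nl ψ j < nl ψ i := by
    intro i
    induction i with
    | zero => intro j hj; omega
    | succ i ih =>
      have h1 : nl ψ i < nl ψ (i+1) := by
        rcases h : ψ i with a | j
        · have := (h_inl hw h).1; omega
        · have := (h_inr hw (hadm i j h) h).1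
          have := ih j (hadm i j h)
          omega
      intro j hj
      rcases Nat.lt_succ_iff_lt_or_eq.1 hj with h | h
      · exact (ih j h).trans h1
      · rw [h]; exact h1
  intro a b hab
  exact key b a hab

def vv (ψ : ℕ → A ⊕ ℕ) : A ⊕ ℕ → ℤ
  | Sum.inl _ => -1
  | Sum.inr j => nl ψ j

/-- main structural fact -/
theorem structI (hadm : Admissible ψ) (hw : ∀ i, pref w (piW ψ i).length = piW ψ i) (i : ℕ)
    (hpal : ∀ j ≤ i, ∀ m < nl ψ j, w (nl ψ j - 1 - m) = w m) :
    ∃ p, 0 < p ∧ nl ψ (i+1) = nl ψ i + p ∧ (p : ℤ) = nl ψ i - vv ψ (ψ i) ∧ p ≤ nl ψ i + 1 ∧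
      ∀ m < nl ψ i, w (m + p) = w m := by
  rcases h : ψ i with a | j
  · obtain ⟨h1, h2, h3⟩ := h_inl hw h
    refine ⟨nl ψ i + 1, by omega, by omega, by simp [vv], by omega, ?_⟩
    intro m hm
    rw [← h3 m hm, add_comm]
  · have hji := hadm i j h
    have hlt := nl_strict hadm hw hji
    obtain ⟨h1, h2⟩ := h_inr hw hji h
    refine ⟨nl ψ i - nl ψ j, by omega, by omega, by simp only [vv]; omega, by omega, ?_⟩
    intro m hm
    by_cases hmj : nl ψ j ≤ m
    · have := h2 (m - nl ψ j) (by omega)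
      rw [show nl ψ i + (m - nl ψ j) = m + (nl ψ i - nl ψ j) by omega,
        show nl ψ j + (m - nl ψ j) = m by omega] at this
      exact this
    · have e1 := hpal i le_rfl (m + (nl ψ i - nl ψ j)) (by omega)
      have e2 := hpal j hji.le m (by omega)
      rw [← e1, ← e2]
      congr 1; omega

theorem pal_all (hadm : Admissible ψ) (hw : ∀ i, pref w (piW ψ i).length = piW ψ i) (i : ℕ) :
    ∀ m < nl ψ i, w (nl ψ i - 1 - m) = w m := by
  induction i using Nat.strong_induction_on with
  | _ i ih =>
  rcases i with _ | i
  · intro m hm; simp [nl, piW] at hm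
  · obtain ⟨p, hp, hn, -, hle, hper⟩ := structI hadm hw i (fun j hj => ih j (by omega))
    intro m hm
    have hi := ih i (by omega)
    by_cases h1 : m < nl ψ i
    · have := hper (nl ψ i - 1 - m) (by omega)
      rw [hi m h1] at this
      rw [← this]; congr 1; omega
    · by_cases h2 : p ≤ m
      · have := hper (m - p) (by omega)
        rw [show m - p + p = m by omega, ← hi (m-p) (by omega)] at this
        rw [this]; congr 1; omega
      · congr 1; omega

theorem structure_all (hadm : Admissible ψ) (hw : ∀ i, pref w (piW ψ i).length = piW ψ i) (i : ℕ) :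
    ∃ p, 0 < p ∧ nl ψ (i+1) = nl ψ i + p ∧ (p : ℤ) = nl ψ i - vv ψ (ψ i) ∧ p ≤ nl ψ i + 1 ∧
      ∀ m < nl ψ i, w (m + p) = w m :=
  structI hadm hw i (fun j _ => pal_all hadm hw j)

theorem per_mul {d : ℕ} (hper : ∀ n, w (n + d) = w n) (n k : ℕ) : w (n + d * k) = w n := by
  induction k with
  | zero => simp
  | succ k ih => rw [Nat.mul_succ, ← add_assoc, hper, ih]

theorem per_mod {d : ℕ} (hper : ∀ n, w (n + d) = w n) (n : ℕ) : w (n % d) = w n := by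
  conv_rhs => rw [← Nat.mod_add_div n d]
  rw [per_mul hper]

theorem fine_wilf {d p : ℕ} (hd : 0 < d) (hper : ∀ n, w (n + d) = w n)
    (hmin : ∀ e, 0 < e → (∀ n, w (n + e) = w n) → d ≤ e)
    (hp : ∀ m, m + 1 < d → w (m + p) = w m) : d ∣ p := by
  have modc : ∀ a b, a % d = b % d → w a = w b := by
    intro a b h
    rw [← per_mod hper a, ← per_mod hper b, h]
  have g1 : ∀ n, n % d ≠ d - 1 → w (n + p) = w n := by
    intro n hn
    have := Nat.mod_lt n hd
    have h := hp (n % d) (by omega)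
    rw [per_mod hper] at h
    rw [← h]
    apply modc
    simp
  have hex : ∃ t, 0 < t ∧ d ∣ t * p := ⟨d, hd, Dvd.intro _ rfl⟩
  classical
  obtain ⟨ht, htd⟩ := Nat.find_spec hex
  have hmin' := fun s => Nat.find_min hex (m := s)
  set t := Nat.find hex with htdef
  have g2 : ∀ n, n % d = d - 1 → w (n + p) = w n := by
    intro n hn
    have step : ∀ s, s + 1 ≤ t → w (n + (s+1) * p) = w (n + p) := by
      intro s
      induction s with
      | zero => intro _; simp
      | succ s ih =>
        intro hs
        rw [← ih (by omega), show n + (s + 1 + 1) * p = n + (s+1)*p + p by ring]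
        apply g1
        intro hc
        apply hmin' (s+1) (by omega)
        refine ⟨by omega, ?_⟩
        have h4 : n + (s+1)*p ≡ n + 0 [MOD d] := by
          simp only [Nat.ModEq, hc, Nat.add_zero, hn]
        exact (Nat.modEq_zero_iff_dvd).1 (Nat.ModEq.add_left_cancel' n h4)
    have h5 := step (t-1) (by omega)
    rw [show t - 1 + 1 = t by omega] at h5
    rw [← h5]
    obtain ⟨c, hc⟩ := htd
    rw [hc, per_mul hper]
  have g : ∀ n, w (n + p) = w n := fun n => by
    by_cases h : n % d = d - 1
    · exact g2 n h
    · exact g1 n h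
  by_contra hnd
  have hpos : 0 < p % d := Nat.pos_of_ne_zero (fun h => hnd (Nat.dvd_of_mod_eq_zero h))
  have := hmin (p % d) hpos (fun n => by
    rw [← g n]; apply modc; simp)
  have := Nat.mod_lt p hd
  omega

theorem backward (hadm : Admissible ψ) (hw : ∀ i, pref w (piW ψ i).length = piW ψ i)
    (h : ∃ N, ∀ i ≥ N, ψ i = Sum.inr (i - 1)) : ∃ d : ℕ, 1 ≤ d ∧ ∀ n, w (n + d) = w n := by
  obtain ⟨N, hN⟩ := h
  have hmono := nl_strict hadm hw
  have hcon : ∀ t, nl ψ (N + t + 1) = nl ψ (N + t) + (nl ψ (N+1) - nl ψ N) := by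
    intro t
    induction t with
    | zero => have := hmono (Nat.lt_succ_self N); simp only [Nat.succ_eq_add_one] at this; simp; omega
    | succ t ih =>
      have hh := hN (N + t + 1) (by omega)
      have h1 := (h_inr hw (hadm _ _ hh) hh).1
      rw [show N + t + 1 - 1 = N + t by omega] at h1
      rw [show N + (t + 1) = N + t + 1 by omega, h1]
      omega
  refine ⟨nl ψ (N+1) - nl ψ N, ?_, ?_⟩
  · have := hmono (Nat.lt_succ_self N); simp only [Nat.succ_eq_add_one] at this; omega
  · intro n
    obtain ⟨p, hp, h1, -, -, h2⟩ := structure_all hadm hw (N + (n+1))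
    have := hcon (n+1)
    have hp' : p = nl ψ (N+1) - nl ψ N := by omega
    rw [← hp']
    apply h2
    have := hmono.id_le (N + (n+1))
    simp only [id] at this
    omega

theorem forward (hadm : Admissible ψ) (hred : Reduced ψ)
    (hw : ∀ i, pref w (piW ψ i).length = piW ψ i)
    (h : ∃ d : ℕ, 1 ≤ d ∧ ∀ n, w (n + d) = w n) : ∃ N, ∀ i ≥ N, ψ i = Sum.inr (i - 1) := by
  classical
  obtain ⟨hd, hper⟩ := Nat.find_spec h
  have hmin : ∀ e, 0 < e → (∀ n, w (n + e) = w n) → Nat.find h ≤ e :=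
    fun e he hpe => Nat.find_min' h ⟨he, hpe⟩
  generalize Nat.find h = d at hd hper hmin
  have hmono := nl_strict hadm hw
  have hexk : ∃ k, d ≤ nl ψ k + 1 := ⟨d, by have := hmono.id_le d; simp only [id] at this; omega⟩
  have hk := Nat.find_spec hexk
  have hkmin := fun s => Nat.find_min hexk (m := s)
  generalize Nat.find hexk = k at hk hkmin
  have hdiv : ∀ i ≥ k, (d : ℤ) ∣ nl ψ i - vv ψ (ψ i) ∧ (d : ℤ) ∣ nl ψ (i+1) - nl ψ i := by
    intro i hi
    obtain ⟨p, hp, h1, h2, h3, h4⟩ := structure_all hadm hw i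
    have := hmono.monotone hi
    have hdp : d ∣ p := fine_wilf hd hper hmin (fun m hm => h4 m (by omega))
    have hdp' : (d : ℤ) ∣ p := by exact_mod_cast hdp
    refine ⟨h2 ▸ hdp', ?_⟩
    rw [h1]; simpa using hdp'
  have hcong : ∀ i ≥ k, (d : ℤ) ∣ nl ψ i - nl ψ k := by
    intro i hi
    induction i, hi using Nat.le_induction with
    | base => simp
    | succ i hi ih =>
      have := dvd_add (hdiv i hi).2 ih
      simpa using this
  -- values below k
  have hbound : ∀ i, (∀ j, ψ i = Sum.inr j → j < k) → -1 ≤ vv ψ (ψ i) ∧ vv ψ (ψ i) + 2 ≤ d := by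
    intro i hi
    rcases hh : ψ i with a | j
    · simp only [vv]; omega
    · have := hkmin j (hi j hh)
      simp only [vv]; omega
  have heq : ∀ i ≥ k, (∀ j, ψ i = Sum.inr j → j < k) → ψ i = ψ k := by
    intro i hi hs
    have b1 := hbound i hs
    have b2 := hbound k (fun j hj => hadm k j hj)
    have hv : vv ψ (ψ i) = vv ψ (ψ k) := by
      have h1 := dvd_add (dvd_sub (hcong i hi) (hdiv i hi).1) (hdiv k le_rfl).1
      have h2 : (d : ℤ) ∣ vv ψ (ψ i) - vv ψ (ψ k) := by
        have e : vv ψ (ψ i) - vv ψ (ψ k) = ((nl ψ i : ℤ) - nl ψ k - (nl ψ i - vv ψ (ψ i))) +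
            (nl ψ k - vv ψ (ψ k)) := by ring
        rw [e]; exact h1
      have := Int.eq_zero_of_abs_lt_dvd h2 (by rw [abs_lt]; constructor <;> omega)
      omega
    rcases h1 : ψ i with a | j <;> rcases h2 : ψ k with b | l <;> rw [h1, h2] at hv <;>
      simp only [vv] at hv
    · rw [← (h_inl hw h1).2.1, ← (h_inl hw h2).2.1]
      have h3 := hcong i hi
      have h4 := hmono.monotone hi
      rw [← Nat.cast_sub h4] at h3
      obtain ⟨c, hc⟩ := (Int.natCast_dvd_natCast.1 h3)
      rw [show nl ψ i = nl ψ k + d * c by omega, per_mul hper]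
    · omega
    · omega
    · rw [hmono.injective (show nl ψ j = nl ψ l by exact_mod_cast hv)]
  have hnotS : ∀ i, i ∉ Sset ψ → ψ i = Sum.inr (i - 1) := by
    intro i hi
    simp only [Sset, Set.mem_ofPred_eq, not_or, not_exists, not_and] at hi
    rcases hh : ψ i with a | j
    · exact absurd hh (hi.1 a)
    · have := hadm i j hh
      have := hi.2 j hh
      congr 1; omega
  have h0 : 0 ∈ Sset ψ := by
    by_contra hc
    have := hadm 0 _ (hnotS 0 hc)
    omega
  refine ⟨k + 1, fun i hi => hnotS i (fun hiS => ?_)⟩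
  have hexi : ∃ i, k < i ∧ i ∈ Sset ψ := ⟨i, hi, hiS⟩
  obtain ⟨hki, hiS'⟩ := Nat.find_spec hexi
  have hfmin := fun s => Nat.find_min hexi (m := s)
  generalize Nat.find hexi = i' at hki hiS' hfmin
  set m := Nat.findGreatest (· ∈ Sset ψ) k with hm
  have hmS : m ∈ Sset ψ := Nat.findGreatest_spec (P := (· ∈ Sset ψ)) (Nat.zero_le k) h0
  have hmk : m ≤ k := Nat.findGreatest_le k
  have hmg : ∀ s, m < s → s ≤ k → s ∉ Sset ψ := fun s h1 h2 =>
    Nat.findGreatest_is_greatest h1 h2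
  obtain ⟨hne, hval⟩ := hred m i' ⟨hmS, hiS', by omega, by
    rintro s hs ⟨h1, h2⟩
    by_cases hsk : s ≤ k
    · exact hmg s h1 hsk hs
    · exact hfmin s h2 ⟨by omega, hs⟩⟩
  have hsm : ∀ j, ψ i' = Sum.inr j → j < m := by
    intro j hj
    rcases hval with ⟨a, ha⟩ | ⟨j', hj', hlt⟩
    · rw [ha] at hj; cases hj
    · rw [hj'] at hj; cases hj; exact hlt
  have he := heq i' hki.le (fun j hj => lt_of_lt_of_le (hsm j hj) hmk)
  by_cases hkS : k ∈ Sset ψ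
  · have : m = k := by
      by_contra hc
      exact hmg k (by omega) le_rfl hkS
    rw [this] at hne
    exact hne he
  · have h1 := hnotS k hkS
    have h2 := hsm (k-1) (he.trans h1)
    have : m ≠ k := fun hc => hkS (hc ▸ hmS)
    omega

end helpers

theorem stmt12 {A : Type*} (ψ : ℕ → A ⊕ ℕ) (hadm : Admissible ψ) (hred : Reduced ψ)
    (w : ℕ → A) (hw : ∀ i, pref w (piW ψ i).length = piW ψ i) :
    (∃ d : ℕ, 1 ≤ d ∧ ∀ n, w (n + d) = w n) ↔
      ∃ N, ∀ i ≥ N, ψ i = Sum.inr (i - 1) := by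
  exact ⟨forward hadm hred hw, backward hadm hw⟩
end

section
/- Let w be an infinite word on an alphabet A whose set P(w) of lengths of palindromic prefixes is infinite, with increasing enumeration (n_i)_{i≥1}; let π_i denote the (palindromic) prefix of w of length n_i, and let i₀ ≥ 1 be an integer. Then the following are equivalent: (i) n_{i+1} ≤ 2n_i + 1 for all i ≥ i₀; (ii) there exists a reduced admissible function ψ such that for every i ≥ i₀: either ψ(i) = a ∈ A and π_{i+1} = π_i a π_i, or ψ(i) = j ∈ ℕ* (with j ≤ i−1) and π_{i+1} = π_i u, where u is the word obtained from π_i by deleting its first |π_j| letters. -/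
open Filter

theorem palP_iff {A : Type*} (w : ℕ → A) (N : ℕ) :
    palP w N ↔ ∀ x < N, w x = w (N - 1 - x) := by
  unfold palP pref
  rw [List.Palindrome.iff_reverse_eq]
  constructor
  · intro h x hx
    have h2 := List.getElem_of_eq h (i := x) (by simpa using hx)
    simp at h2
    exact h2.symm
  · intro h
    apply List.ext_getElem
    · simp
    · intro x h1 h2
      simp at h1 h2 ⊢
      exact (h x h2).symm

theorem per_of_pal {A : Type*} {w : ℕ → A} {N p : ℕ} (h1 : palP w N) (h2 : palP w (N + p)) :
    ∀ x < N, w (x + p) = w x := by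
  rw [palP_iff] at h1 h2
  intro x hx
  rw [h2 (x + p) (by omega), h1 x hx]
  congr 1
  omega

theorem per_mul_s13 {A : Type*} {w : ℕ → A} {N p : ℕ} (h : ∀ x, x + p < N → w (x + p) = w x) :
    ∀ t x, x + t * p < N → w (x + t * p) = w x := by
  intro t
  induction t with
  | zero => simp
  | succ t ih =>
    intro x hx
    have e : x + (t + 1) * p = (x + t * p) + p := by ring
    rw [e] at hx ⊢
    rw [h _ hx, ih x (by omega)]

theorem ext_pal {A : Type*} {w : ℕ → A} {N p t : ℕ} (hp : 0 < p) (hpN : p ≤ N)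
    (h0 : palP w (N - p)) (h1 : palP w N) (h2 : palP w (N + (t + 1) * p))
    (hq : (t + 1) * p ≤ N ∨ ((t + 1) * p = N + 1 ∧ w N = w (N - p))) :
    palP w (N + p) := by
  have P1 : ∀ x, x + p < N → w (x + p) = w x := by
    intro x hx
    apply per_of_pal h0 (by rwa [Nat.sub_add_cancel hpN]) x (by omega)
  have P2 := per_of_pal h1 h2
  have P3 := per_mul_s13 P1
  have e : (t + 1) * p = t * p + p := by ring
  have key : ∀ x < N, w (x + p) = w x := by
    intro x hx
    by_cases hx2 : x + p < N
    · exact P1 x hx2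
    by_cases hx3 : (t + 1) * p ≤ x + p
    · have := P2 (x + p - (t + 1) * p) (by omega)
      rw [Nat.sub_add_cancel hx3] at this
      rw [this]
      have h4 := P3 t (x + p - (t + 1) * p) (by omega)
      rw [← h4]
      congr 1
      omega
    · rcases hq with hq | ⟨hq, hw⟩
      · omega
      · have : x = N - p := by omega
        subst this
        rw [Nat.sub_add_cancel hpN, hw]
  have h1' := (palP_iff w N).1 h1
  rw [palP_iff]
  intro x hx
  by_cases hxN : x < N
  · have e1 : N + p - 1 - x = (N - 1 - x) + p := by omega
    rw [e1, key _ (by omega), h1' x hxN]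
  · have e1 : x = (x - p) + p := by omega
    have := key (x - p) (by omega)
    rw [← e1] at this
    rw [this, h1' _ (by omega)]
    congr 1
    omega

theorem arith_prog {n : ℕ → ℕ} (hn : StrictMono n) {m N : ℕ} (hmN : m < N)
    (hs : ∀ k, m < k → k < N → n (k + 1) + n (k - 1) = 2 * n k) :
    ∀ t, m + t < N → n (m + t + 1) = n (m + t) + (n (m + 1) - n m) ∧
      n (m + t) = n m + t * (n (m + 1) - n m) := by
  intro t
  have h0 : n m < n (m + 1) := hn (by omega)
  induction t with
  | zero => intro _; simp; omega
  | succ t ih =>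
    intro h
    have ih := ih (by omega)
    have h1 := hs (m + (t + 1)) (by omega) h
    have e : m + (t + 1) - 1 = m + t := by omega
    rw [e] at h1
    have e2 : (t + 1) * (n (m + 1) - n m) = t * (n (m + 1) - n m) + (n (m + 1) - n m) := by ring
    rw [e2]
    have e3 : m + (t + 1) = m + t + 1 := by omega
    rw [e3] at h1 ⊢
    omega

theorem arith_prog' {n : ℕ → ℕ} (hn : StrictMono n) {m N : ℕ} (hmN : m < N)
    (hs : ∀ k, m < k → k < N → n (k + 1) + n (k - 1) = 2 * n k) :
    ∃ p, 0 < p ∧ n N = n (N - 1) + p ∧ n (m + 1) = n m + p ∧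
      ∀ t, m + t ≤ N → n (m + t) = n m + t * p := by
  have h0 : n m < n (m + 1) := hn (by omega)
  refine ⟨n (m + 1) - n m, by omega, ?_, by omega, ?_⟩
  · have := (arith_prog hn hmN hs (N - 1 - m) (by omega)).1
    rw [show m + (N - 1 - m) + 1 = N by omega, show m + (N - 1 - m) = N - 1 by omega] at this
    exact this
  · intro t ht
    rcases t with _ | t
    · simp
    · have := arith_prog hn hmN hs t (by omega)
      rw [← add_assoc, this.1, this.2]
      ring

theorem no_ext {A : Type*} {w : ℕ → A} {n : ℕ → ℕ} (hn : StrictMono n)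
    (hr : ∀ k, palP w k ↔ ∃ i, n i = k) {N p t : ℕ} (hN : 0 < N) (hp : 0 < p)
    (h0 : n N = n (N - 1) + p) (h1 : n (N + 1) = n N + (t + 2) * p)
    (hq : (t + 2) * p ≤ n N ∨ ((t + 2) * p = n N + 1 ∧ w (n N) = w (n N - p))) : False := by
  have : palP w (n N + p) := by
    apply ext_pal (t := t + 1) hp (by omega) _ ((hr _).2 ⟨_, rfl⟩) ((hr _).2 ⟨_, h1⟩) hq
    exact (hr _).2 ⟨N - 1, by omega⟩
  obtain ⟨i, hi⟩ := (hr _).1 this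
  have a : N < i := hn.lt_iff_lt.1 (by omega)
  have e : (t + 2) * p = t * p + 2 * p := by ring
  have b : i < N + 1 := hn.lt_iff_lt.1 (by omega)
  omega

theorem coreL {A : Type*} {w : ℕ → A} {n : ℕ → ℕ} (hn : StrictMono n)
    (hr : ∀ k, palP w k ↔ ∃ i, n i = k) {m N j : ℕ} (hmN : m < N)
    (hs : ∀ k, m < k → k < N → n (k + 1) + n (k - 1) = 2 * n k)
    (h : n (N + 1) + n j = 2 * n N) (hj : j + 2 ≤ N) : j < m := by
  by_contra hc
  push Not at hc
  obtain ⟨p, hp, h1, h2, h3⟩ := arith_prog' hn hmN hs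
  obtain ⟨s, rfl⟩ := Nat.exists_eq_add_of_le hc
  obtain ⟨t, rfl⟩ := Nat.exists_eq_add_of_le hj
  have a := h3 s (by omega)
  have b := h3 (s + 2 + t) (by omega)
  rw [show m + (s + 2 + t) = m + s + 2 + t by omega] at b
  have e : (s + 2 + t) * p = s * p + (t + 2) * p := by ring
  exact no_ext hn hr (by omega) hp h1 (t := t) (by omega) (Or.inl (by omega))

theorem coreE1 {A : Type*} {w : ℕ → A} {n : ℕ → ℕ} (hn : StrictMono n)
    (hr : ∀ k, palP w k ↔ ∃ i, n i = k) {m N : ℕ} (hmN : m < N)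
    (hs : ∀ k, m < k → k < N → n (k + 1) + n (k - 1) = 2 * n k)
    (h : n (N + 1) = 2 * n N + 1) (h' : n (m + 1) = 2 * n m + 1) : w (n N) ≠ w (n m) := by
  intro hw
  obtain ⟨p, hp, h1, h2, h3⟩ := arith_prog' hn hmN hs
  obtain ⟨t, rfl⟩ := Nat.exists_eq_add_of_lt hmN
  have b := h3 (t + 1) (by omega)
  rw [← add_assoc] at b
  have e : (t + 2) * p = (t + 1) * p + p := by ring
  have e' : (t + 1) * p = t * p + p := by ring
  refine no_ext hn hr (by omega) hp h1 (t := t) (by omega) (Or.inr ⟨by omega, ?_⟩)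
  have P1 : ∀ x, x + p < n (m + t + 1) → w (x + p) = w x := by
    intro x hx
    refine per_of_pal ((hr _).2 ⟨_, rfl⟩) ((hr _).2 ⟨_, h1⟩) x (by omega)
  have := per_mul_s13 P1 t (n m) (by omega)
  rw [hw, ← this]
  congr 1
  omega

theorem coreE2 {A : Type*} {w : ℕ → A} {n : ℕ → ℕ} (hn : StrictMono n)
    (hr : ∀ k, palP w k ↔ ∃ i, n i = k) {m N j : ℕ} (hmN : m < N)
    (hs : ∀ k, m < k → k < N → n (k + 1) + n (k - 1) = 2 * n k)
    (h : n (N + 1) + n j = 2 * n N) (h' : n (m + 1) + n j = 2 * n m) : False := by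
  obtain ⟨p, hp, h1, h2, h3⟩ := arith_prog' hn hmN hs
  obtain ⟨t, rfl⟩ := Nat.exists_eq_add_of_lt hmN
  have b := h3 (t + 1) (by omega)
  rw [← add_assoc] at b
  have e : (t + 2) * p = (t + 1) * p + p := by ring
  exact no_ext hn hr (by omega) hp h1 (t := t) (by omega) (Or.inl (by omega))

theorem exists_val {A : Type*} {w : ℕ → A} {n : ℕ → ℕ} (hn : StrictMono n)
    (hr : ∀ k, palP w k ↔ ∃ i, n i = k) {i : ℕ} (h : n (i + 1) ≤ 2 * n i + 1) :
    (n (i + 1) = 2 * n i + 1) ∨ ∃ j, j < i ∧ n (i + 1) + n j = 2 * n i := by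
  by_cases h1 : n (i + 1) = 2 * n i + 1
  · exact Or.inl h1
  right
  have hlt : n i < n (i + 1) := hn (by omega)
  obtain ⟨p, hp⟩ := Nat.exists_eq_add_of_lt hlt
  have P := per_of_pal (w := w) (N := n i) (p := p + 1) ((hr _).2 ⟨_, rfl⟩)
    ((hr _).2 ⟨i + 1, by omega⟩)
  have hpal := (palP_iff w (n i)).1 ((hr _).2 ⟨_, rfl⟩)
  have : palP w (n i - (p + 1)) := by
    rw [palP_iff]
    intro x hx
    have a := P x (by omega)
    rw [← a, hpal _ (by omega)]
    congr 1
    omega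
  obtain ⟨j, hj⟩ := (hr _).1 this
  exact ⟨j, hn.lt_iff_lt.1 (by omega), by omega⟩

theorem pref_inl {A : Type*} {w : ℕ → A} {N : ℕ} (h1 : palP w N) (h2 : palP w (2 * N + 1)) :
    pref w (2 * N + 1) = pref w N ++ w N :: pref w N := by
  have P := per_of_pal (w := w) (N := N) (p := N + 1) h1 (by convert h2 using 1; omega)
  apply List.ext_getElem
  · simp [pref]; omega
  · intro x hx _
    simp only [pref, List.length_map, List.length_range] at hx
    by_cases hxN : x < N
    · rw [List.getElem_append_left (by simpa [pref] using hxN)]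
      simp [pref]
    · rw [List.getElem_append_right (by simp [pref]; omega)]
      rw [List.getElem_cons]
      split_ifs with h
      · simp [pref] at h ⊢
        congr 1
        omega
      · simp [pref] at h ⊢
        refine Eq.trans ?_ (P (x - N - 1) (by omega))
        congr 1
        omega

theorem pref_inr {A : Type*} {w : ℕ → A} {N M J : ℕ} (h1 : palP w N) (h2 : palP w M)
    (hJ : J < N) (h : M + J = 2 * N) :
    pref w M = pref w N ++ (pref w N).drop (pref w J).length := by
  have P := per_of_pal (w := w) (N := N) (p := N - J) h1 (by convert h2 using 1; omega)
  apply List.ext_getElem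
  · simp [pref]; omega
  · intro x hx _
    simp only [pref, List.length_map, List.length_range] at hx
    by_cases hxN : x < N
    · rw [List.getElem_append_left (by simpa [pref] using hxN)]
      simp [pref]
    · rw [List.getElem_append_right (by simp [pref]; omega)]
      simp [pref]
      refine Eq.trans ?_ (P (J + (x - N)) (by omega))
      congr 1
      omega

theorem subsing_case {A : Type*} [Subsingleton A] {w : ℕ → A} {n : ℕ → ℕ} (hn : StrictMono n)
    (hr : ∀ k, palP w k ↔ ∃ i, n i = k) : ∀ i, n i = i := by
  have hs : Function.Surjective n := fun k => (hr k).1 ((palP_iff w k).2 fun _ _ =>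
    Subsingleton.elim _ _)
  intro i
  have := Subsingleton.elim (hn.orderIsoOfSurjective n hs) (OrderIso.refl ℕ)
  exact congrArg (fun g : ℕ ≃o ℕ => g i) this

/-- The value of `ψ` at `i` is the right one. -/
def Good {A : Type*} (w : ℕ → A) (n : ℕ → ℕ) (i : ℕ) (v : A ⊕ ℕ) : Prop :=
  (n (i + 1) = 2 * n i + 1 ∧ v = Sum.inl (w (n i))) ∨
    ∃ j, j < i ∧ n (i + 1) + n j = 2 * n i ∧ v = Sum.inr j

theorem exists_psi {A : Type*} {w : ℕ → A} {n : ℕ → ℕ} (hn : StrictMono n)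
    (hr : ∀ k, palP w k ↔ ∃ i, n i = k) (i0 : ℕ) (h : ∀ i ≥ i0, n (i + 1) ≤ 2 * n i + 1) :
    ∃ ψ : ℕ → A ⊕ ℕ, Admissible ψ ∧ Reduced ψ ∧ ∀ i ≥ i0, Good w n i (ψ i) := by
  classical
  cases subsingleton_or_nontrivial A with
  | inl hA =>
    have hid := subsing_case hn hr
    refine ⟨fun i => if i = 0 then Sum.inl (w 0) else Sum.inr (i - 1), ?_, ?_, ?_⟩
    · intro i j hij
      by_cases hi : i = 0
      · simp [hi] at hij
      · simp [hi] at hij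
        omega
    · have hS : ∀ k ∈ Sset (fun i => if i = 0 then Sum.inl (w 0) else Sum.inr (i - 1) : ℕ → A ⊕ ℕ),
          k = 0 := by
        intro k hk
        by_contra hk0
        simp [Sset, hk0] at hk
        omega
      rintro m k ⟨hm, hk, hlt, -⟩
      have := hS m hm
      have := hS k hk
      omega
    · intro i _
      unfold Good
      simp only [hid]
      by_cases hi : i = 0
      · left; simp [hi]
      · right; exact ⟨i - 1, by omega, by omega, by simp [hi]⟩
  | inr hA =>
    have hf : ∀ i, ∃ v, i ≥ i0 → Good w n i v := by
      intro i
      by_cases hi : i ≥ i0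
      · rcases exists_val hn hr (h i hi) with h1 | ⟨j, h1, h2⟩
        · exact ⟨_, fun _ => Or.inl ⟨h1, rfl⟩⟩
        · exact ⟨_, fun _ => Or.inr ⟨j, h1, h2, rfl⟩⟩
      · exact ⟨Sum.inr 0, fun h => absurd h hi⟩
    choose f hf using hf
    have hc : ∃ c : A, ∀ k ≥ i0, k ∈ Sset f → (∀ l ∈ Sset f, i0 ≤ l → k ≤ l) →
        f k ≠ Sum.inl c := by
      by_cases hk : ∃ k b, k ≥ i0 ∧ k ∈ Sset f ∧ (∀ l ∈ Sset f, i0 ≤ l → k ≤ l) ∧ f k = Sum.inl b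
      · obtain ⟨k, b, h1, h2, h3, h4⟩ := hk
        obtain ⟨c, hc⟩ := exists_ne b
        refine ⟨c, fun k' h1' h2' h3' h4' => hc ?_⟩
        have : k = k' := le_antisymm (h3 _ h2' h1') (h3' _ h2 h1)
        subst this
        rw [h4] at h4'
        exact (Sum.inl_injective h4').symm
      · push Not at hk
        exact ⟨w 0, fun k h1 h2 h3 => hk k _ h1 h2 h3⟩
    obtain ⟨c, hc⟩ := hc
    obtain ⟨d, hd⟩ := exists_ne c
    set ψ : ℕ → A ⊕ ℕ := fun i => if i0 ≤ i then f i else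
      if (i0 - 1 - i) % 2 = 0 then Sum.inl c else Sum.inl d with hψ
    have hψ1 : ∀ i, i0 ≤ i → ψ i = f i := fun i hi => by simp [hψ, hi]
    have hψ2 : ∀ i, i < i0 → ψ i = if (i0 - 1 - i) % 2 = 0 then Sum.inl c else Sum.inl d :=
      fun i hi => by simp [hψ, Nat.not_le.2 hi]
    have hψ3 : ∀ i, i < i0 → ∃ a, ψ i = Sum.inl a := by
      intro i hi
      rw [hψ2 i hi]
      split_ifs
      · exact ⟨_, rfl⟩
      · exact ⟨_, rfl⟩
    have hS : ∀ i, i0 ≤ i → (i ∈ Sset ψ ↔ i ∈ Sset f) := by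
      intro i hi
      simp only [Sset, Set.mem_setOf_eq, hψ1 i hi]
    have hG : ∀ i ≥ i0, Good w n i (ψ i) := fun i hi => by rw [hψ1 i hi]; exact hf i hi
    have hnS : ∀ k, i0 ≤ k → k ∉ Sset ψ → n (k + 1) + n (k - 1) = 2 * n k := by
      intro k hk hkS
      rcases hG k hk with ⟨_, h2⟩ | ⟨j, h1, h2, h3⟩
      · exact absurd (Or.inl ⟨_, h2⟩) hkS
      · have : ¬ (j + 2 ≤ k) := fun h => hkS (Or.inr ⟨j, h3, h⟩)
        have : j = k - 1 := by omega
        rw [← this]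
        exact h2
    refine ⟨ψ, ?_, ?_, hG⟩
    · intro i j hij
      by_cases hi : i0 ≤ i
      · rcases hG i hi with ⟨_, h2⟩ | ⟨j', h1, h2, h3⟩
        · rw [h2] at hij; cases hij
        · rw [h3] at hij; cases hij; exact h1
      · obtain ⟨a, ha⟩ := hψ3 i (by omega)
        rw [ha] at hij; cases hij
    · rintro m k ⟨hm, hk, hlt, hmid⟩
      by_cases hki : k < i0
      · refine ⟨?_, Or.inl (hψ3 k hki)⟩
        have : k = m + 1 := by
          by_contra hne
          exact hmid (m + 1) (Or.inl (hψ3 _ (by omega))) ⟨by omega, by omega⟩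
        subst this
        rw [hψ2 _ hki, hψ2 m (by omega)]
        split_ifs
        · omega
        · intro e; exact hd (Sum.inl_injective e).symm
        · intro e; exact hd (Sum.inl_injective e)
        · omega
      push Not at hki
      have hs : i0 ≤ m + 1 → ∀ l, m < l → l < k → n (l + 1) + n (l - 1) = 2 * n l :=
        fun h0 l h1 h2 => hnS l (by omega) fun h3 => hmid l h3 ⟨h1, h2⟩
      have hm1 : i0 ≤ m + 1 := by
        by_contra hne
        exact hmid (m + 1) (Or.inl (hψ3 _ (by omega))) ⟨by omega, by omega⟩
      have hs := hs hm1
      constructor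
      · by_cases hmi : i0 ≤ m
        · intro e
          rcases hG k hki with ⟨h1, h2⟩ | ⟨j, h1, h2, h3⟩
          · rcases hG m hmi with ⟨h1', h2'⟩ | ⟨j', h1', h2', h3'⟩
            · rw [h2, h2'] at e
              exact coreE1 hn hr hlt hs h1 h1' (Sum.inl_injective e)
            · rw [h2, h3'] at e; cases e
          · rcases hG m hmi with ⟨h1', h2'⟩ | ⟨j', h1', h2', h3'⟩
            · rw [h3, h2'] at e; cases e
            · rw [h3, h3'] at e
              cases e
              exact coreE2 hn hr hlt hs h2 h2'
        · rw [hψ2 m (by omega), hψ1 k hki, if_pos (by omega)]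
          apply hc k hki ((hS k hki).1 hk)
          intro l hl hl0
          by_contra hlk
          exact hmid l ((hS l hl0).2 hl) ⟨by omega, by omega⟩
      · rcases hk with h1 | ⟨j, h1, h2⟩
        · exact Or.inl h1
        · right
          refine ⟨j, h1, ?_⟩
          rcases hG k hki with ⟨_, h2'⟩ | ⟨j', h1', h2', h3'⟩
          · rw [h1] at h2'; cases h2'
          · rw [h1] at h3'
            cases h3'
            exact coreL hn hr hlt hs h2' h2

theorem stmt13 {A : Type*} (w : ℕ → A) (hinf : (setOf (palP w)).Infinite) (i0 : ℕ) :
    (∀ i ≥ i0, Nat.nth (palP w) (i + 1) ≤ 2 * Nat.nth (palP w) i + 1) ↔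
    ∃ ψ : ℕ → A ⊕ ℕ, Admissible ψ ∧ Reduced ψ ∧
      ∀ i ≥ i0,
        (∃ a : A, ψ i = Sum.inl a ∧
          pref w (Nat.nth (palP w) (i + 1)) =
            pref w (Nat.nth (palP w) i) ++ a :: pref w (Nat.nth (palP w) i)) ∨
        (∃ j : ℕ, ψ i = Sum.inr j ∧ j < i ∧
          pref w (Nat.nth (palP w) (i + 1)) =
            pref w (Nat.nth (palP w) i) ++
              (pref w (Nat.nth (palP w) i)).drop (pref w (Nat.nth (palP w) j)).length) := by
  have hn : StrictMono (Nat.nth (palP w)) := Nat.nth_strictMono hinf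
  have hr : ∀ k, palP w k ↔ ∃ i, Nat.nth (palP w) i = k := by
    classical
    intro k
    constructor
    · intro hk
      exact ⟨_, Nat.nth_count hk⟩
    · rintro ⟨i, rfl⟩
      exact Nat.nth_mem_of_infinite hinf i
  generalize Nat.nth (palP w) = n at hn hr
  constructor
  · intro h
    obtain ⟨ψ, h1, h2, h3⟩ := exists_psi hn hr i0 h
    refine ⟨ψ, h1, h2, fun i hi => ?_⟩
    rcases h3 i hi with ⟨h4, h5⟩ | ⟨j, h4, h5, h6⟩
    · left
      refine ⟨_, h5, ?_⟩
      rw [h4]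
      exact pref_inl ((hr _).2 ⟨_, rfl⟩) (h4 ▸ (hr _).2 ⟨_, rfl⟩)
    · right
      exact ⟨j, h6, h4, pref_inr ((hr _).2 ⟨_, rfl⟩) ((hr _).2 ⟨_, rfl⟩) (hn h4) h5⟩
  · rintro ⟨ψ, -, -, h⟩ i hi
    rcases h i hi with ⟨a, -, h1⟩ | ⟨j, -, -, h1⟩
    · have := congrArg List.length h1
      simp [pref] at this
      omega
    · have := congrArg List.length h1
      simp [pref] at this
      omega
end

section
/- Let ψ be a reduced admissible function with δ(ψ) < 2, let (n_i)_{i≥1} be its associated sequence, and let (n'_i)_{i≥1} be an increasing sequence of nonnegative integers such that for all sufficiently large i one has ψ(i) ∈ ℕ* and n'_{i+1} = 2n'_i − n'_{ψ(i)}. Then the quotient n'_i/n_i converges to a finite positive limit as i → ∞, and limsup_{i→∞} n'_{i+1}/n'_i = δ(ψ). -/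
open Filter

section Aux

variable {A : Type*} {ψ : ℕ → A ⊕ ℕ}

lemma nseq_inl {i : ℕ} {a : A} (h : ψ i = Sum.inl a) : nseq ψ (i + 1) = 2 * nseq ψ i + 1 := by
  rw [nseq, h]

lemma nseq_inr {i j : ℕ} (h : ψ i = Sum.inr j) (hj : j < i) :
    nseq ψ (i + 1) = 2 * nseq ψ i - nseq ψ j := by
  rw [nseq, h]
  simp [min_eq_left hj.le]

lemma nseq_strict (hadm : Admissible ψ) : StrictMono (nseq ψ) := by
  have key : ∀ i, ∀ j < i, nseq ψ j < nseq ψ i := by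
    intro i
    induction i with
    | zero => intro j hj; omega
    | succ i ih =>
      have h1 : nseq ψ i < nseq ψ (i + 1) := by
        rcases h : ψ i with a | j
        · rw [nseq_inl h]; omega
        · have hj := hadm i j h
          rw [nseq_inr h hj]
          have := ih j hj
          omega
      intro j hj
      rcases Nat.lt_succ_iff_lt_or_eq.mp hj with h | h
      · exact (ih j h).trans h1
      · rw [h]; exact h1
  intro a b h
  exact key b a h

lemma zero_memS (hadm : Admissible ψ) : 0 ∈ Sset ψ := by
  rcases h : ψ 0 with a | j
  · exact Or.inl ⟨a, h⟩
  · exact absurd (hadm 0 j h) (by omega)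

lemma not_memS (hadm : Admissible ψ) {i : ℕ} (h : i + 1 ∉ Sset ψ) : ψ (i + 1) = Sum.inr i := by
  rcases h' : ψ (i + 1) with a | j
  · exact absurd (Or.inl ⟨a, h'⟩) h
  · have h1 := hadm _ j h'
    by_cases h2 : j + 2 ≤ i + 1
    · exact absurd (Or.inr ⟨j, h', h2⟩) h
    · have : j = i := by omega
      rw [this]

lemma prevS (hadm : Admissible ψ) (i : ℕ) :
    ∃ b < i + 1, b ∈ Sset ψ ∧ ∀ k, b < k → k < i + 1 → k ∉ Sset ψ := by
  induction i with
  | zero => exact ⟨0, by omega, zero_memS hadm, fun k h1 h2 => by omega⟩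
  | succ i ih =>
    by_cases h : i + 1 ∈ Sset ψ
    · exact ⟨i + 1, by omega, h, fun k h1 h2 => by omega⟩
    · obtain ⟨b, hb, hbS, hk⟩ := ih
      refine ⟨b, by omega, hbS, fun k h1 h2 => ?_⟩
      by_cases h3 : k = i + 1
      · rw [h3]; exact h
      · exact hk k h1 (by omega)

/-- differences -/
def dif (x : ℕ → ℕ) (i : ℕ) : ℝ := (x (i + 1) : ℝ) - x i

lemma dif_const (hadm : Admissible ψ) {b i : ℕ}
    (hk : ∀ k, b < k → k < i → k ∉ Sset ψ) : ∀ k, b ≤ k → k < i →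
      dif (nseq ψ) k = dif (nseq ψ) b := by
  intro k hbk
  induction k, hbk using Nat.le_induction with
  | base => intro _; rfl
  | succ k hbk ih =>
    intro hki
    rw [← ih (by omega)]
    have h1 := not_memS hadm (hk (k + 1) (by omega) hki)
    have h2 := nseq_inr h1 (by omega)
    have h3 := nseq_strict hadm (show k < k + 1 by omega)
    have h4 : (nseq ψ (k + 1 + 1) : ℝ) = 2 * nseq ψ (k + 1) - nseq ψ k := by
      rw [h2, Nat.cast_sub (by omega)]; push_cast; ring
    unfold dif
    rw [h4]; ring

lemma S_bound (hadm : Admissible ψ) (hred : Reduced ψ) :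
    ∀ b ∈ Sset ψ, (nseq ψ b : ℝ) ≤ 2 * dif (nseq ψ) b := by
  have hm := nseq_strict hadm
  have hlet : ∀ b a, ψ b = Sum.inl a → (nseq ψ b : ℝ) ≤ dif (nseq ψ) b := by
    intro b a h
    have := nseq_inl h
    unfold dif
    rw [this]; push_cast; linarith
  have hinr : ∀ b j, ψ b = Sum.inr j → dif (nseq ψ) b = nseq ψ b - nseq ψ j := by
    intro b j h
    have hj := hadm _ _ h
    have := hm hj
    unfold dif
    rw [nseq_inr h hj, Nat.cast_sub (by omega)]; push_cast; ring
  have hmr : ∀ i j, i ≤ j → (nseq ψ i : ℝ) ≤ nseq ψ j := by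
    intro i j h
    exact_mod_cast hm.monotone h
  intro b
  induction b using Nat.strong_induction_on with
  | _ b ih =>
    intro hb
    rcases h : ψ b with a | j
    · have := hlet b a h
      have h0 : (0:ℝ) ≤ nseq ψ b := by positivity
      linarith
    · have hj := hadm _ _ h
      obtain ⟨b0, rfl⟩ : ∃ b0, b = b0 + 1 := ⟨b - 1, by omega⟩
      obtain ⟨b', hb', hb'S, hk'⟩ := prevS hadm b0
      have hr := hred b' (b0 + 1) ⟨hb'S, hb, hb', fun k hk h => hk' k h.1 h.2 hk⟩
      have hjb : j < b' := by
        rcases hr.2 with ⟨a, h'⟩ | ⟨j', h', h''⟩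
        · rw [h] at h'; cases h'
        · rw [h] at h'; cases h'; exact h''
      obtain ⟨c, rfl⟩ : ∃ c, b' = c + 1 := ⟨b' - 1, by omega⟩
      obtain ⟨b'', hb'', hb''S, hk''⟩ := prevS hadm c
      have hc := dif_const hadm hk'' c (by omega) (by omega)
      have hI := ih b'' (by omega) hb''S
      have h1 := hinr _ _ h
      have h2 : (nseq ψ j : ℝ) ≤ nseq ψ c := hmr _ _ (by omega)
      have h3 : dif (nseq ψ) c = nseq ψ (c + 1) - nseq ψ c := rfl
      have h4 : (nseq ψ (c + 1 + 1) : ℝ) ≤ nseq ψ (b0 + 1) := hmr _ _ (by omega)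
      have h5 : dif (nseq ψ) (c + 1) = nseq ψ (c + 1 + 1) - nseq ψ (c + 1) := rfl
      have h6 : (nseq ψ (c + 1) : ℝ) - nseq ψ b'' ≤ dif (nseq ψ) (c + 1) := by
        rcases h' : ψ (c + 1) with a | l
        · have := hlet _ a h'
          have h0 : (0:ℝ) ≤ nseq ψ b'' := by positivity
          linarith
        · rw [hinr _ _ h']
          have hr := hred b'' (c + 1) ⟨hb''S, hb'S, hb'', fun k hk h => hk'' k h.1 h.2 hk⟩
          have : l < b'' := by
            rcases hr.2 with ⟨a, h''⟩ | ⟨j', h'', h'''⟩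
            · rw [h'] at h''; cases h''
            · rw [h'] at h''; cases h''; exact h'''
          have := hmr l b'' this.le
          linarith
      linarith

lemma growth (hadm : Admissible ψ) (hred : Reduced ψ) [DecidablePred (· ∈ Sset ψ)] (j i : ℕ)
    (hji : j ≤ i) : (3 / 2 : ℝ) ^ (Nat.count (· ∈ Sset ψ) i - Nat.count (· ∈ Sset ψ) j) * nseq ψ j
      ≤ nseq ψ i := by
  induction i, hji using Nat.le_induction with
  | base => simp
  | succ i hi ih =>
    have hmon := Nat.count_monotone (· ∈ Sset ψ) hi
    rw [Nat.count_succ]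
    split_ifs with h
    · have := S_bound hadm hred i h
      unfold dif at this
      rw [show Nat.count (· ∈ Sset ψ) i + 1 - Nat.count (· ∈ Sset ψ) j
        = (Nat.count (· ∈ Sset ψ) i - Nat.count (· ∈ Sset ψ) j) + 1 by omega, pow_succ]
      linarith
    · have : (nseq ψ i : ℝ) ≤ nseq ψ (i + 1) := by
        exact_mod_cast (nseq_strict hadm).monotone (Nat.le_succ i)
      simpa using ih.trans this

end Aux

lemma rec_nonneg {e : ℕ → ℝ} {p : ℕ → ℕ} {N a : ℕ}
    (he : ∀ i ≥ N, e i = ∑ k ∈ Finset.Ico (p i) i, e k) (ha : ∀ i ≥ N, a ≤ p i)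
    (h0 : ∀ k, a ≤ k → k < N → 0 ≤ e k) : ∀ k, a ≤ k → 0 ≤ e k := by
  intro k
  induction k using Nat.strong_induction_on with
  | _ k ih =>
    intro hk
    by_cases h : k < N
    · exact h0 k hk h
    · rw [he k (by omega)]
      apply Finset.sum_nonneg
      intro l hl
      rw [Finset.mem_Ico] at hl
      exact ih l hl.2 ((ha k (by omega)).trans hl.1)

lemma contract {d e : ℕ → ℝ} {p c : ℕ → ℕ} {i0 K : ℕ} {η t : ℝ} (hη : 0 ≤ η) (hη1 : η ≤ 1)
    (ht : 0 ≤ t) (hd : ∀ i, 0 < d i) (hc : Monotone c)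
    (he : ∀ i ≥ i0, e i = ∑ k ∈ Finset.Ico (p i) i, e k)
    (hdr : ∀ i ≥ i0, d i = ∑ k ∈ Finset.Ico (p i) i, d k)
    (step : ∀ i ≥ i0, (c (i + 1) = c i ∧ e (i + 1) = e i ∧ d (i + 1) = d i) ∨
      (c (i + 1) = c i + 1 ∧ η * e i * d (i + 1) ≤ e (i + 1) * d i))
    (hK : ∀ i ≥ i0, c i ≤ c (p i) + K) (h0 : t * d i0 ≤ e i0) :
    ∀ i ≥ i0, η ^ K * t * d i ≤ e i := by
  have h1 : ∀ i ≥ i0, η ^ (c i - c i0) * t * d i ≤ e i := by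
    intro i hi
    induction i, hi using Nat.le_induction with
    | base => simpa using h0
    | succ i hi ih =>
      have := hc hi
      rcases step i hi with ⟨h1, h2, h3⟩ | ⟨h1, h2⟩
      · rw [h1, h2, h3]; exact ih
      · rw [h1, show c i + 1 - c i0 = (c i - c i0) + 1 by omega, pow_succ]
        refine le_of_mul_le_mul_right (le_trans ?_ h2) (hd i)
        have := mul_le_mul_of_nonneg_left ih (mul_nonneg hη (hd (i + 1)).le)
        linarith
  intro i
  induction i using Nat.strong_induction_on with
  | _ i ih =>
    intro hi
    by_cases h : c i ≤ c i0 + K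
    · refine le_trans ?_ (h1 i hi)
      have : η ^ K ≤ η ^ (c i - c i0) := pow_le_pow_of_le_one hη hη1 (by omega)
      exact mul_le_mul_of_nonneg_right (mul_le_mul_of_nonneg_right this ht) (hd i).le
    · have hp : i0 ≤ p i := by
        by_contra hp
        have := hc (show p i ≤ i0 by omega)
        have := hK i hi
        omega
      rw [he i hi, hdr i hi, Finset.mul_sum]
      apply Finset.sum_le_sum
      intro l hl
      rw [Finset.mem_Ico] at hl
      exact ih l hl.2 (hp.trans hl.1)

lemma sum_dif (x : ℕ → ℕ) {j i : ℕ} (h : j ≤ i) :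
    ∑ k ∈ Finset.Ico j i, dif x k = (x i : ℝ) - x j := by
  induction i, h using Nat.le_induction with
  | base => simp
  | succ i hi ih => rw [Finset.sum_Ico_succ_top hi, ih]; unfold dif; ring

section Core

variable {A : Type*} {ψ : ℕ → A ⊕ ℕ}

lemma stepL (hadm : Admissible ψ) (hred : Reduced ψ) [DecidablePred (· ∈ Sset ψ)]
    {e : ℕ → ℝ} {p : ℕ → ℕ} {N a i : ℕ} (hψ : ∀ i ≥ N, ψ i = Sum.inr (p i))
    (he : ∀ i ≥ N, e i = ∑ k ∈ Finset.Ico (p i) i, e k) (hi : N ≤ i)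
    (hprev : ∀ b, ConsecIn (Sset ψ) b (i + 1) → N ≤ b) (hpos : ∀ k, a ≤ k → 0 ≤ e k)
    (ha : a ≤ p (i + 1)) (hai : a ≤ i) :
    (Nat.count (· ∈ Sset ψ) (i + 1 + 1) = Nat.count (· ∈ Sset ψ) (i + 1) ∧ e (i + 1) = e i ∧
      dif (nseq ψ) (i + 1) = dif (nseq ψ) i) ∨
    (Nat.count (· ∈ Sset ψ) (i + 1 + 1) = Nat.count (· ∈ Sset ψ) (i + 1) + 1 ∧
      (1 / 3) * e i * dif (nseq ψ) (i + 1) ≤ e (i + 1) * dif (nseq ψ) i) := by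
  have hm := nseq_strict hadm
  have hnon : ∀ k, N ≤ k + 1 → k + 1 ∉ Sset ψ → e (k + 1) = e k := by
    intro k hk hkS
    have h1 := not_memS hadm hkS
    have h2 := hψ (k + 1) hk
    rw [h1] at h2
    have h3 : p (k + 1) = k := by injection h2 with h2; exact h2.symm
    rw [he _ hk, h3]; simp
  rw [Nat.count_succ]
  by_cases hS : i + 1 ∈ Sset ψ
  · right
    refine ⟨by simp [hS], ?_⟩
    obtain ⟨b, hb, hbS, hk⟩ := prevS hadm i
    have hcons : ConsecIn (Sset ψ) b (i + 1) := ⟨hbS, hS, hb, fun k hk' h => hk k h.1 h.2 hk'⟩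
    have hNb := hprev b hcons
    have hψi := hψ (i + 1) (by omega)
    have hpb : p (i + 1) < b := by
      rcases (hred _ _ hcons).2 with ⟨a, h'⟩ | ⟨j', h', h''⟩
      · rw [hψi] at h'; cases h'
      · rw [hψi] at h'; cases h'; exact h''
    have hdc := dif_const hadm hk
    have hec : ∀ k, b ≤ k → k < i + 1 → e k = e b := by
      intro k hbk
      induction k, hbk using Nat.le_induction with
      | base => intro _; rfl
      | succ k hbk ih =>
        intro hki
        rw [← ih (by omega)]
        exact hnon k (by omega) (hk _ (by omega) hki)
    have e1 : ∑ k ∈ Finset.Ico b (i + 1), e k = ((i + 1 - b : ℕ) : ℝ) * e b := by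
      rw [Finset.sum_congr rfl (fun k hk => hec k (Finset.mem_Ico.1 hk).1 (Finset.mem_Ico.1 hk).2)]
      simp
    have d1 : ∑ k ∈ Finset.Ico b (i + 1), dif (nseq ψ) k
        = ((i + 1 - b : ℕ) : ℝ) * dif (nseq ψ) b := by
      rw [Finset.sum_congr rfl (fun k hk => hdc k (Finset.mem_Ico.1 hk).1 (Finset.mem_Ico.1 hk).2)]
      simp
    rw [sum_dif _ hb.le] at d1
    have e2 : ∑ k ∈ Finset.Ico b (i + 1), e k ≤ e (i + 1) := by
      rw [he (i + 1) (by omega)]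
      apply Finset.sum_le_sum_of_subset_of_nonneg
      · exact Finset.Ico_subset_Ico_left hpb.le
      · intro k hk _
        exact hpos k (ha.trans (Finset.mem_Ico.1 hk).1)
    have hSb := S_bound hadm hred b hbS
    have hb1 : (nseq ψ (b + 1) : ℝ) ≤ nseq ψ (i + 1) := by exact_mod_cast hm.monotone hb
    have hdb : dif (nseq ψ) b = nseq ψ (b + 1) - nseq ψ b := rfl
    have hdi : dif (nseq ψ) (i + 1) ≤ nseq ψ (i + 1) := by
      have hlt := hm (show p (i + 1) < i + 1 by omega)
      unfold dif
      rw [nseq_inr hψi (by omega), Nat.cast_sub (by omega)]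
      have : (0:ℝ) ≤ nseq ψ (p (i + 1)) := by positivity
      push_cast; linarith
    have hdpos : 0 < dif (nseq ψ) b := by
      have : (nseq ψ b : ℝ) < nseq ψ (b + 1) := by exact_mod_cast hm (Nat.lt_succ_self b)
      linarith
    rw [hec i (by omega) (by omega), hdc i (by omega) (by omega)]
    have heb : 0 ≤ e b := by
      rw [← hec i (by omega) (by omega)]; exact hpos i hai
    have h3 : dif (nseq ψ) (i + 1) ≤ 3 * (((i + 1 - b : ℕ) : ℝ) * dif (nseq ψ) b) := by
      linarith
    have h4 := mul_le_mul_of_nonneg_left h3 heb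
    have h5 := mul_le_mul_of_nonneg_right (e1 ▸ e2) hdpos.le
    linarith
  · left
    refine ⟨by simp [hS], hnon i (by omega) hS, ?_⟩
    have h := dif_const hadm (b := i) (i := i + 2) (fun k h1 h2 => by
      have : k = i + 1 := by omega
      rw [this]; exact hS)
    exact h (i + 1) (by omega) (by omega)

lemma core (hadm : Admissible ψ) (hred : Reduced ψ) {p : ℕ → ℕ} {N : ℕ} {c0 : ℝ} (hc0 : 0 < c0)
    (hN1 : 1 ≤ N) (hψ : ∀ i ≥ N, ψ i = Sum.inr (p i))
    (hbd : ∀ i ≥ N, c0 * nseq ψ i ≤ nseq ψ (p i))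
    (n' : ℕ → ℕ) (hmono : StrictMono n')
    (hrec : ∀ i ≥ N, dif n' i = n' i - n' (p i)) :
    ∃ L : ℝ, 0 < L ∧ Tendsto (fun i => dif n' i / dif (nseq ψ) i) atTop (nhds L) := by
  classical
  have hm := nseq_strict hadm
  have hp : ∀ i ≥ N, p i < i := fun i hi => hadm i _ (hψ i hi)
  set d := dif (nseq ψ) with hd
  set d' := dif n' with hd'
  have hdpos : ∀ i, 0 < d i := by
    intro i
    have : (nseq ψ i : ℝ) < nseq ψ (i + 1) := by exact_mod_cast hm (Nat.lt_succ_self i)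
    simp only [hd, dif]; linarith
  have hd'pos : ∀ i, 0 < d' i := by
    intro i
    have : (n' i : ℝ) < n' (i + 1) := by exact_mod_cast hmono (Nat.lt_succ_self i)
    simp only [hd', dif]; linarith
  have hdr : ∀ i ≥ N, d i = ∑ k ∈ Finset.Ico (p i) i, d k := by
    intro i hi
    have hlt := hm (hp i hi)
    rw [hd, sum_dif _ (hp i hi).le]
    unfold dif
    rw [nseq_inr (hψ i hi) (hp i hi), Nat.cast_sub (by omega)]
    push_cast; ring
  have hd'r : ∀ i ≥ N, d' i = ∑ k ∈ Finset.Ico (p i) i, d' k := by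
    intro i hi
    rw [hd', sum_dif _ (hp i hi).le, ← hd', hrec i hi]
  -- previous element
  obtain ⟨N', hN', hprev⟩ : ∃ N' ≥ N, ∀ i ≥ N', ∀ b, ConsecIn (Sset ψ) b (i + 1) → N ≤ b := by
    by_cases h : ∃ s ≥ N, s ∈ Sset ψ
    · obtain ⟨s, hs, hsS⟩ := h
      refine ⟨s, hs, fun i hi b hb => ?_⟩
      have := hb.2.2.2 s hsS
      omega
    · push Not at h
      refine ⟨N, le_rfl, fun i hi b hb => ?_⟩
      exact absurd hb.2.1 (h _ (by omega))
  -- memory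
  obtain ⟨K, hK⟩ : ∃ K : ℕ, ∀ i ≥ N, Nat.count (· ∈ Sset ψ) (i + 1)
      ≤ Nat.count (· ∈ Sset ψ) (p i + 1) + K := by
    obtain ⟨K, hK⟩ := pow_unbounded_of_one_lt (1 / c0) (show (1:ℝ) < 3 / 2 by norm_num)
    refine ⟨K + 1, fun i hi => ?_⟩
    have hg := growth hadm hred (p i) i (hp i hi).le
    have hmon := Nat.count_monotone (· ∈ Sset ψ) (hp i hi).le
    have h1 : Nat.count (· ∈ Sset ψ) (i + 1) ≤ Nat.count (· ∈ Sset ψ) i + 1 := by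
      rw [Nat.count_succ]; split_ifs <;> omega
    have h2 := Nat.count_monotone (· ∈ Sset ψ) (Nat.le_succ (p i))
    by_contra hcon
    have h3 : K ≤ Nat.count (· ∈ Sset ψ) i - Nat.count (· ∈ Sset ψ) (p i) := by
      simp only [Nat.succ_eq_add_one] at h2
      omega
    have h4 : (3 / 2 : ℝ) ^ K ≤ (3 / 2 : ℝ) ^
      (Nat.count (· ∈ Sset ψ) i - Nat.count (· ∈ Sset ψ) (p i)) :=
      pow_le_pow_right₀ (by norm_num) h3
    have hni : (0:ℝ) < nseq ψ i := by
      have := hm.id_le i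
      have : 0 < nseq ψ i := by simp only [id] at this; omega
      exact_mod_cast this
    have h5 := hbd i hi
    have hpp : (0:ℝ) < nseq ψ (p i) := lt_of_lt_of_le (by positivity) h5
    have h6 : 1 / c0 * (nseq ψ (p i) : ℝ) < nseq ψ i :=
      lt_of_lt_of_le (mul_lt_mul_of_pos_right (hK.trans_le h4) hpp) hg
    have h7 := mul_lt_mul_of_pos_left h6 hc0
    have h8 : c0 * (1 / c0 * (nseq ψ (p i) : ℝ)) = nseq ψ (p i) := by field_simp
    linarith
  -- p tends to infinity
  have hpinf : ∀ a, ∃ i0 ≥ N', ∀ i ≥ i0, a ≤ p i := by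
    intro a
    obtain ⟨B, hB⟩ := exists_nat_gt ((nseq ψ a : ℝ) / c0)
    refine ⟨max N' B, le_max_left _ _, fun i hi => ?_⟩
    have hiN : N ≤ i := hN'.trans ((le_max_left _ _).trans hi)
    have hiB : B ≤ i := (le_max_right _ _).trans hi
    by_contra hcon
    have h1 : (nseq ψ (p i) : ℝ) ≤ nseq ψ a := by exact_mod_cast hm.monotone (by omega)
    have h2 := hbd i hiN
    have h3 : (B : ℝ) ≤ nseq ψ i := by exact_mod_cast hiB.trans (hm.id_le i)
    rw [div_lt_iff₀ hc0] at hB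
    nlinarith
  set q : ℝ := 1 - (1 / 3 : ℝ) ^ K with hq
  have hθ0 : (0:ℝ) < (1 / 3 : ℝ) ^ K := by positivity
  have hθ1 : (1 / 3 : ℝ) ^ K ≤ 1 := pow_le_one₀ (by norm_num) (by norm_num)
  have hcm : Monotone (fun i => Nat.count (· ∈ Sset ψ) (i + 1)) := fun i j h =>
    Nat.count_monotone _ (by omega)
  -- linear combos
  have hcomb : ∀ u v : ℝ, ∀ i ≥ N, (u * d i + v * d' i)
      = ∑ k ∈ Finset.Ico (p i) i, (u * d k + v * d' k) := by
    intro u v i hi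
    rw [Finset.sum_add_distrib, ← Finset.mul_sum, ← Finset.mul_sum, ← hdr i hi, ← hd'r i hi]
  have hcontr : ∀ u v t : ℝ, ∀ a i0, N' ≤ i0 → a ≤ i0 → (∀ i ≥ i0, a ≤ p i) →
      (∀ k, a ≤ k → 0 ≤ u * d k + v * d' k) → 0 ≤ t → t * d i0 ≤ u * d i0 + v * d' i0 →
      ∀ i ≥ i0, (1 / 3 : ℝ) ^ K * t * d i ≤ u * d i + v * d' i := by
    intro u v t a i0 hi0 hai0 hap hpos ht h0
    refine contract (d := d) (e := fun k => u * d k + v * d' k) (p := p)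
      (c := fun i => Nat.count (· ∈ Sset ψ) (i + 1)) (by norm_num) (by norm_num) ht hdpos hcm
      (fun i hi => hcomb u v i (by omega)) (fun i hi => hdr i (by omega)) ?_
      (fun i hi => hK i (by omega)) h0
    intro i hi
    exact stepL hadm hred hψ (hcomb u v) (by omega) (hprev i (by omega)) hpos
      (hap (i + 1) (by omega)) (by omega)
  -- initial bounds
  obtain ⟨m0, M0, hm0, hmM0, hinit⟩ : ∃ m0 M0 : ℝ, 0 < m0 ∧ m0 ≤ M0 ∧
      ∀ k, m0 * d k ≤ d' k ∧ d' k ≤ M0 * d k := by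
    have hne : (Finset.range (N + 1)).Nonempty := ⟨0, by simp⟩
    obtain ⟨k1, -, hk1⟩ := Finset.exists_min_image (Finset.range (N + 1)) (fun k => d' k / d k) hne
    obtain ⟨k2, -, hk2⟩ := Finset.exists_max_image (Finset.range (N + 1)) (fun k => d' k / d k) hne
    refine ⟨d' k1 / d k1, d' k2 / d k2, div_pos (hd'pos _) (hdpos _), ?_, fun k => ⟨?_, ?_⟩⟩
    · exact (hk1 0 (by simp)).trans (hk2 0 (by simp))
    · have := rec_nonneg (hcomb (-(d' k1 / d k1)) 1) (a := 0) (fun _ _ => Nat.zero_le _)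
        (fun k _ hk => by
          have := hk1 k (by simp; omega)
          rw [le_div_iff₀ (hdpos k)] at this
          linarith) k (Nat.zero_le _)
      linarith
    · have := rec_nonneg (hcomb (d' k2 / d k2) (-1)) (a := 0) (fun _ _ => Nat.zero_le _)
        (fun k _ hk => by
          have := hk2 k (by simp; omega)
          rw [div_le_iff₀ (hdpos k)] at this
          linarith) k (Nat.zero_le _)
      linarith
  have hstage : ∀ t : ℕ, ∃ a : ℕ, ∃ m M : ℝ, M - m ≤ q ^ t * (M0 - m0) ∧
      ∀ k, a ≤ k → m * d k ≤ d' k ∧ d' k ≤ M * d k := by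
    intro t
    induction t with
    | zero => exact ⟨0, m0, M0, by simp, fun k _ => hinit k⟩
    | succ t ih =>
      obtain ⟨a, m, M, hmM, hb⟩ := ih
      obtain ⟨i1, hi1, hap⟩ := hpinf a
      set i0 := max i1 a
      have hi01 : i1 ≤ i0 := le_max_left _ _
      have hai0 : a ≤ i0 := le_max_right _ _
      set r := d' i0 / d i0 with hr
      have hrd : r * d i0 = d' i0 := div_mul_cancel₀ _ (hdpos i0).ne'
      have hmr : m ≤ r := by rw [hr, le_div_iff₀ (hdpos i0)]; exact (hb i0 hai0).1
      have hrM : r ≤ M := by rw [hr, div_le_iff₀ (hdpos i0)]; exact (hb i0 hai0).2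
      have c1 := hcontr M (-1) (M - r) a i0 (hi1.trans hi01) hai0
        (fun i hi => hap i (hi01.trans hi)) (fun k hk => by linarith [(hb k hk).2])
        (by linarith) (by linarith)
      have c2 := hcontr (-m) 1 (r - m) a i0 (hi1.trans hi01) hai0
        (fun i hi => hap i (hi01.trans hi)) (fun k hk => by linarith [(hb k hk).1])
        (by linarith) (by linarith)
      refine ⟨i0, m + (1 / 3 : ℝ) ^ K * (r - m), M - (1 / 3 : ℝ) ^ K * (M - r), ?_,
        fun k hk => ⟨?_, ?_⟩⟩
      · have hq0 : 0 ≤ q := by linarith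
        have := mul_le_mul_of_nonneg_left hmM hq0
        rw [pow_succ]
        calc _ = q * (M - m) := by rw [hq]; ring
          _ ≤ _ := this
          _ = _ := by ring
      · linarith [c2 k hk]
      · linarith [c1 k hk]
  have hcau : CauchySeq (fun i => d' i / d i) := by
    rw [Metric.cauchySeq_iff']
    intro ε hε
    have hq0 : 0 ≤ q := by linarith
    have hq1 : q < 1 := by linarith
    have ht : Tendsto (fun t : ℕ => q ^ t * (M0 - m0)) atTop (nhds (0 * (M0 - m0))) :=
      (tendsto_pow_atTop_nhds_zero_of_lt_one hq0 hq1).mul_const _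
    rw [zero_mul] at ht
    obtain ⟨t, ht⟩ := (ht.eventually (gt_mem_nhds hε)).exists
    obtain ⟨a, m, M, hmM, hb⟩ := hstage t
    have hb' : ∀ k, a ≤ k → m ≤ d' k / d k ∧ d' k / d k ≤ M := by
      intro k hk
      rw [le_div_iff₀ (hdpos k), div_le_iff₀ (hdpos k)]
      exact hb k hk
    refine ⟨a, fun n hn => ?_⟩
    rw [Real.dist_eq, abs_lt]
    have h1 := hb' n hn
    have h2 := hb' a le_rfl
    constructor <;> linarith
  obtain ⟨L, hL⟩ := cauchySeq_tendsto_of_complete hcau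
  refine ⟨L, lt_of_lt_of_le hm0 (ge_of_tendsto' hL fun k => ?_), hL⟩
  rw [le_div_iff₀ (hdpos k)]
  exact (hinit k).1

end Core

lemma stolz {n n' : ℕ → ℕ} (hn : StrictMono n) (h0 : n 0 = 0) {L : ℝ}
    (h : Tendsto (fun i => dif n' i / dif n i) atTop (nhds L)) :
    Tendsto (fun i => (n' i : ℝ) / n i) atTop (nhds L) := by
  have hdpos : ∀ i, 0 < dif n i := by
    intro i
    have : (n i : ℝ) < n (i + 1) := by exact_mod_cast hn (Nat.lt_succ_self i)
    simp only [dif]; linarith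
  have hs : ∀ x : ℕ → ℕ, ∀ i, ∑ k ∈ Finset.range i, dif x k = x i - x 0 := by
    intro x i
    rw [Finset.range_eq_Ico, sum_dif _ (Nat.zero_le i)]
  have hinf : Tendsto (fun i => (n i : ℝ)) atTop atTop :=
    tendsto_natCast_atTop_atTop.comp hn.tendsto_atTop
  have ho : (fun i => dif n' i - L * dif n i) =o[atTop] (dif n) := by
    rw [Asymptotics.isLittleO_iff_tendsto (fun i hi => absurd hi (hdpos i).ne')]
    have := h.sub_const L
    rw [sub_self] at this
    refine this.congr fun i => ?_
    have := (hdpos i).ne'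
    field_simp
  have hsum := ho.sum_range (fun i => (hdpos i).le) (by
    simp only [hs, h0, Nat.cast_zero, sub_zero]; exact hinf)
  simp only [Finset.sum_sub_distrib, ← Finset.mul_sum, hs, h0, Nat.cast_zero, sub_zero] at hsum
  have h1 := hsum.tendsto_div_nhds_zero
  have h2 : Tendsto (fun i => (n' 0 : ℝ) / n i) atTop (nhds 0) := hinf.const_div_atTop _
  have h3 := (h1.add h2).add_const L
  rw [add_zero, zero_add] at h3
  refine h3.congr' ?_
  filter_upwards [eventually_gt_atTop 0] with i hi
  have : 0 < n i := lt_of_lt_of_le hi (hn.id_le i)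
  have : (n i : ℝ) ≠ 0 := by exact_mod_cast this.ne'
  field_simp
  ring

lemma limsup_le_of_ratio {x y : ℕ → ENNReal} {v : ℕ → ENNReal} (hv : Tendsto v atTop (nhds 1))
    (h : ∀ᶠ i in atTop, x i = y i * v i) : limsup x atTop ≤ limsup y atTop := by
  have h1 : limsup x atTop = limsup (y * v) atTop := limsup_congr h
  have h2 : limsup v atTop = 1 := hv.limsup_eq
  rw [h1]
  refine (ENNReal.limsup_mul_le' (by simp [h2]) (by simp [h2])).trans ?_
  rw [h2, mul_one]

lemma limsup_le_of_quot {n n' : ℕ → ℕ} (hn : StrictMono n) (hn' : StrictMono n') {L : ℝ}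
    (hL : 0 < L) (h : Tendsto (fun i => (n' i : ℝ) / n i) atTop (nhds L)) :
    limsup (fun i => (n' (i + 1) : ENNReal) / (n' i : ENNReal)) atTop ≤
    limsup (fun i => (n (i + 1) : ENNReal) / (n i : ENNReal)) atTop := by
  have h1 := ((tendsto_add_atTop_iff_nat 1).2 h).div h hL.ne'
  rw [div_self hL.ne'] at h1
  have h2 := ENNReal.tendsto_ofReal h1
  rw [ENNReal.ofReal_one] at h2
  refine limsup_le_of_ratio h2 ?_
  filter_upwards [eventually_gt_atTop 0] with i hi
  have a1 : (0:ℝ) < n i := by exact_mod_cast lt_of_lt_of_le hi (hn.id_le i)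
  have a2 : (0:ℝ) < n' i := by exact_mod_cast lt_of_lt_of_le hi (hn'.id_le i)
  have a3 : (0:ℝ) < n (i + 1) := by
    exact_mod_cast lt_of_lt_of_le (Nat.succ_pos i) (hn.id_le (i + 1))
  rw [← ENNReal.ofReal_natCast (n i), ← ENNReal.ofReal_natCast (n' i),
    ← ENNReal.ofReal_natCast (n (i + 1)), ← ENNReal.ofReal_natCast (n' (i + 1)),
    ← ENNReal.ofReal_div_of_pos a1, ← ENNReal.ofReal_div_of_pos a2,
    ← ENNReal.ofReal_mul (by positivity)]
  congr 1
  simp only [Pi.div_apply]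
  field_simp

theorem stmt14 {A : Type*} (ψ : ℕ → A ⊕ ℕ) (hadm : Admissible ψ) (hred : Reduced ψ)
    (hδ : deltaPsi ψ < 2) (n' : ℕ → ℕ) (hmono : StrictMono n')
    (hrec : ∃ N, ∀ i ≥ N, ∃ j : ℕ, ψ i = Sum.inr j ∧
      (n' (i + 1) : ℤ) = 2 * (n' i : ℤ) - (n' j : ℤ)) :
    (∃ L : ℝ, 0 < L ∧
      Filter.Tendsto (fun i => (n' i : ℝ) / (nseq ψ i : ℝ)) atTop (nhds L)) ∧
    limsup (fun i => (n' (i + 1) : ENNReal) / (n' i : ENNReal)) atTop = deltaPsi ψ := by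
  obtain ⟨N, hN⟩ := hrec
  have hm := nseq_strict hadm
  obtain ⟨q, hq1, hq2⟩ := exists_between hδ
  have hqtop : q ≠ ⊤ := ne_top_of_lt hq2
  have hev := eventually_lt_of_limsup_lt hq1
  obtain ⟨N1, hN1⟩ := eventually_atTop.1 hev
  have hqr : q.toReal < 2 := by
    have := (ENNReal.toReal_lt_toReal hqtop (by simp)).2 hq2
    simpa using this
  choose! p hp using hN
  have hmain : ∃ L : ℝ, 0 < L ∧
      Tendsto (fun i => dif n' i / dif (nseq ψ) i) atTop (nhds L) := by
    refine core hadm hred (p := p) (N := max (max N N1) 1) (c0 := 2 - q.toReal) (by linarith)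
      (le_max_right _ _) (fun i hi => (hp i (by omega)).1) ?_ n' hmono ?_
    · intro i hi
      have hψ := (hp i (by omega)).1
      have hpi := hadm i _ hψ
      have hlt := hm hpi
      have h1 := hN1 i (by omega)
      have a1 : (0:ℝ) < nseq ψ i := by
        exact_mod_cast lt_of_lt_of_le (show 0 < i by omega) (hm.id_le i)
      rw [← ENNReal.ofReal_natCast (nseq ψ i), ← ENNReal.ofReal_natCast (nseq ψ (i + 1)),
        ← ENNReal.ofReal_div_of_pos a1, ENNReal.ofReal_lt_iff_lt_toReal (by positivity) hqtop,
        div_lt_iff₀ a1, nseq_inr hψ hpi, Nat.cast_sub (by omega)] at h1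
      push_cast at h1
      linarith
    · intro i hi
      have h := (hp i (by omega)).2
      have h' : (n' (i + 1) : ℝ) = 2 * n' i - n' (p i) := by exact_mod_cast h
      unfold dif
      rw [h']; ring
  obtain ⟨L, hL, hT⟩ := hmain
  have hT2 := stolz hm (by rw [nseq]) hT
  refine ⟨⟨L, hL, hT2⟩, le_antisymm (limsup_le_of_quot hm hmono hL hT2) ?_⟩
  refine limsup_le_of_quot hmono hm (inv_pos.2 hL) ?_
  refine (hT2.inv₀ hL.ne').congr fun i => ?_
  rw [inv_div]
end

section
/- Let ψ be a reduced admissible function such that δ(ψ) < √3. Then either the set S(ψ) is finite, or there exists an integer K such that for every pair m < n of consecutive elements of S(ψ) with n ≥ K, one has ψ(n) = m − 1 (in particular ψ(n) ∈ ℕ*). -/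
open Filter

lemma nseq_succ_inl {A : Type*} {ψ : ℕ → A ⊕ ℕ} {i : ℕ} {a : A} (h : ψ i = Sum.inl a) :
    nseq ψ (i + 1) = 2 * nseq ψ i + 1 := by
  rw [nseq, h]

lemma nseq_succ_inr' {A : Type*} {ψ : ℕ → A ⊕ ℕ} (hadm : Admissible ψ) {i j : ℕ}
    (h : ψ i = Sum.inr j) : nseq ψ (i + 1) = 2 * nseq ψ i - nseq ψ j := by
  have := hadm i j h
  rw [nseq, h]
  simp only [min_eq_left this.le]

lemma nseq_lt_succ {A : Type*} {ψ : ℕ → A ⊕ ℕ} (hadm : Admissible ψ) (i : ℕ) :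
    nseq ψ i < nseq ψ (i + 1) := by
  induction i using Nat.strong_induction_on with
  | _ i ih =>
    rcases h : ψ i with a | j
    · rw [nseq_succ_inl h]; omega
    · rw [nseq_succ_inr' hadm h]
      have hj := hadm i j h
      have key : ∀ k, j < k → k ≤ i → nseq ψ j < nseq ψ k := by
        intro k hk
        induction k, hk using Nat.le_induction with
        | base => intro hk'; exact ih j hj
        | succ k hk ihk =>
          intro hk'
          exact (ihk (by omega)).trans (ih k (by omega))
      have := key i hj le_rfl
      omega

lemma nseq_sm {A : Type*} {ψ : ℕ → A ⊕ ℕ} (hadm : Admissible ψ) : StrictMono (nseq ψ) :=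
  strictMono_nat_of_lt_succ (nseq_lt_succ hadm)

lemma nseq_succ_inr {A : Type*} {ψ : ℕ → A ⊕ ℕ} (hadm : Admissible ψ) {i j : ℕ}
    (h : ψ i = Sum.inr j) : (nseq ψ (i + 1) : ℤ) = 2 * nseq ψ i - nseq ψ j := by
  have h1 := nseq_succ_inr' hadm h
  have := nseq_sm hadm (hadm i j h)
  omega

/-- the defect -/
def Cdef {A : Type*} (ψ : ℕ → A ⊕ ℕ) (i : ℕ) : ℤ :=
  nseq ψ (i - 1) + nseq ψ i - nseq ψ (i + 1)

lemma not_S {A : Type*} {ψ : ℕ → A ⊕ ℕ} (hadm : Admissible ψ) {k : ℕ} (h : k ∉ Sset ψ) :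
    1 ≤ k ∧ ψ k = Sum.inr (k - 1) := by
  rcases hk : ψ k with a | j
  · exact absurd (Or.inl ⟨a, hk⟩) h
  · have := hadm k j hk
    have h2 : ¬ (j + 2 ≤ k) := fun h2 => h (Or.inr ⟨j, hk, h2⟩)
    refine ⟨by omega, ?_⟩
    congr 1; omega

lemma diff_const {A : Type*} {ψ : ℕ → A ⊕ ℕ} (hadm : Admissible ψ) {m n : ℕ}
    (h : ConsecIn (Sset ψ) m n) (k : ℕ) (hk : m ≤ k) : k < n →
    (nseq ψ (k + 1) : ℤ) - nseq ψ k = nseq ψ (m + 1) - nseq ψ m := by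
  induction k, hk using Nat.le_induction with
  | base => intro _; rfl
  | succ k hk ih =>
    intro hkn
    have h1 : k + 1 ∉ Sset ψ := fun hS => h.2.2.2 _ hS ⟨by omega, hkn⟩
    have h2 := nseq_succ_inr hadm (not_S hadm h1).2
    have := ih (by omega)
    simp only [Nat.add_sub_cancel] at h2
    omega

lemma exists_pred (S : Set ℕ) {p m : ℕ} (hp : p ∈ S) (hm : m ∈ S) (hpm : p < m) :
    ∃ l, p ≤ l ∧ ConsecIn S l m := by
  classical
  have hex : ∃ l, l ≤ m - 1 ∧ (l ∈ S) := ⟨p, by omega, hp⟩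
  refine ⟨Nat.findGreatest (· ∈ S) (m - 1), Nat.le_findGreatest (by omega) hp, ?_, hm, ?_, ?_⟩
  · exact Nat.findGreatest_spec (P := (· ∈ S)) (m := p) (by omega) hp
  · have := Nat.findGreatest_le (P := (· ∈ S)) (m - 1)
    omega
  · rintro k hk ⟨h1, h2⟩
    have := Nat.le_findGreatest (P := (· ∈ S)) (n := m - 1) (m := k) (by omega) hk
    omega

lemma C_step {A : Type*} {ψ : ℕ → A ⊕ ℕ} (hadm : Admissible ψ) {m n j : ℕ}
    (h : ConsecIn (Sset ψ) m n) (hj : ψ n = Sum.inr j) :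
    Cdef ψ n = Cdef ψ m - (nseq ψ (m - 1) - nseq ψ j) := by
  have h0 := h.2.2.1
  have h1 := diff_const hadm h (n - 1) (by omega) (by omega)
  rw [show n - 1 + 1 = n by omega] at h1
  have h2 := nseq_succ_inr hadm hj
  unfold Cdef
  omega

lemma real1 {s x y C : ℝ} (hs : s ^ 2 = 3) (h0 : 0 < s) (hC : C ≤ 0)
    (h1 : x + C - y > (2 - s) * (2 * x + y + C)) (h2 : x < (s - 1) * (x + y + C)) : False := by
  have h3 : 0 < s * ((s - 1) * (x + y + C) - x) := mul_pos h0 (by linarith)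
  have : s * ((s - 1) * (x + y + C) - x) + (x + C - y - (2 - s) * (2 * x + y + C)) = 2 * C := by
    linear_combination (x + y + C) * hs
  linarith

lemma real2 {s x y z C C' : ℝ} (hs : s ^ 2 = 3) (h0 : 1 < s) (h02 : s < 2) (hC : C ≤ 0)
    (hx : C' = C + y + z - x) (hCC : C' ≤ C)
    (h1 : x + C' - z > (2 - s) * (2 * x + y + C')) (h2 : y < (s - 1) * (y + z + C)) : False := by
  have h3 : 0 < (s - 1) * ((s - 1) * (y + z + C) - y) := mul_pos (by linarith) (by linarith)
  have h4 : 0 ≤ (2 - s) * (C - C') := mul_nonneg (by linarith) (by linarith)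
  have h5 : 0 ≤ (3 - s) * (-C) := mul_nonneg (by linarith) (by linarith)
  have hx' : x = y + z + (C - C') := by linarith
  subst hx'
  have : (s - 1) * ((s - 1) * (y + z + C) - y) + (y + z + (C - C') + C' - z
      - (2 - s) * (2 * (y + z + (C - C')) + y + C')) = (3 - s) * C - (2 - s) * (C - C') := by
    linear_combination (y + z + C) * hs
  linarith

lemma local_good {A : Type*} {ψ : ℕ → A ⊕ ℕ} (hadm : Admissible ψ) {s : ℝ} (hs : s ^ 2 = 3)
    (h0 : 1 < s) (h02 : s < 2) {l m n a b : ℕ} (hl1 : 1 ≤ l)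
    (hlt : ∀ i, l ≤ i → (nseq ψ (i + 1) : ℝ) < s * nseq ψ i)
    (hlm : ConsecIn (Sset ψ) l m) (hmn : ConsecIn (Sset ψ) m n)
    (ha : ψ m = Sum.inr a) (hal : a < l) (hb : ψ n = Sum.inr b) (hbm : b < m)
    (hC : Cdef ψ l ≤ 0) : b + 1 = m := by
  by_contra hne
  have hlm' := hlm.2.2.1
  have hmn' := hmn.2.2.1
  have sm := nseq_sm hadm
  have e1 := C_step hadm hlm ha
  have mono1 : nseq ψ a ≤ nseq ψ (l - 1) := sm.monotone (by omega)
  have d1 := diff_const hadm hlm (m - 1) (by omega) (by omega)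
  rw [show m - 1 + 1 = m by omega] at d1
  have nb := nseq_succ_inr hadm hb
  have q1 : nseq ψ (m + 1) ≤ nseq ψ n := sm.monotone (by omega)
  have q2 : nseq ψ b ≤ nseq ψ (m - 2) := sm.monotone (by omega)
  have rl := hlt l le_rfl
  have rm := hlt m (by omega)
  have rn := hlt n (by omega)
  have hCm : Cdef ψ m ≤ Cdef ψ l := by omega
  have cl : Cdef ψ l = nseq ψ (l - 1) + nseq ψ l - nseq ψ (l + 1) := rfl
  have cm : Cdef ψ m = nseq ψ (m - 1) + nseq ψ m - nseq ψ (m + 1) := rfl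
  -- real casts
  have nb' : (nseq ψ (n + 1) : ℝ) = 2 * nseq ψ n - nseq ψ b := by exact_mod_cast nb
  have q1' : (nseq ψ (m + 1) : ℝ) ≤ nseq ψ n := by exact_mod_cast q1
  have q2' : (nseq ψ b : ℝ) ≤ nseq ψ (m - 2) := by exact_mod_cast q2
  have d1' : (nseq ψ m : ℝ) - nseq ψ (m - 1) = nseq ψ (l + 1) - nseq ψ l := by exact_mod_cast d1
  have key : (nseq ψ (m - 2) : ℝ) > (2 - s) * nseq ψ (m + 1) := by
    have : (2 - s) * nseq ψ (m + 1) ≤ (2 - s) * (nseq ψ n : ℝ) :=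
      mul_le_mul_of_nonneg_left q1' (by linarith)
    linarith
  have hCl' : (nseq ψ (l - 1) : ℝ) + nseq ψ l - nseq ψ (l + 1) ≤ 0 := by
    rw [cl] at hC; exact_mod_cast hC
  have hCC' : (nseq ψ (m - 1) : ℝ) + nseq ψ m - nseq ψ (m + 1)
      ≤ (nseq ψ (l - 1) : ℝ) + nseq ψ l - nseq ψ (l + 1) := by
    rw [cl, cm] at hCm; exact_mod_cast hCm
  by_cases hk : l = m - 1
  · have hm2 : m - 2 = l - 1 := by omega
    have hm : l + 1 = m := by omega
    rw [hm2] at key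
    rw [← hk] at hCC' d1'
    subst hm
    refine real2 (s := s) (x := nseq ψ (l + 1 + 1) - nseq ψ (l + 1))
      (y := nseq ψ (l + 1) - nseq ψ l) (z := nseq ψ l - nseq ψ (l - 1))
      hs h0 h02 hCl' (C' := (nseq ψ l : ℝ) + nseq ψ (l + 1) - nseq ψ (l + 1 + 1))
      (by ring) hCC' ?_ ?_
    · ring_nf at key ⊢
      linarith
    · ring_nf at rl ⊢
      linarith
  · have d2 := diff_const hadm hlm (m - 2) (by omega) (by omega)
    rw [show m - 2 + 1 = m - 1 by omega] at d2
    have d2' : (nseq ψ (m - 1) : ℝ) - nseq ψ (m - 2) = nseq ψ (l + 1) - nseq ψ l := by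
      exact_mod_cast d2
    refine real1 (s := s) (x := nseq ψ (m + 1) - nseq ψ m)
      (y := nseq ψ m - nseq ψ (m - 1))
      (C := (nseq ψ (m - 1) : ℝ) + nseq ψ m - nseq ψ (m + 1)) hs (by linarith)
      (by linarith) ?_ ?_
    · have : (nseq ψ (m - 2) : ℝ) = 2 * nseq ψ (m - 1) - nseq ψ m := by linarith
      rw [this] at key
      ring_nf at key ⊢
      linarith
    · ring_nf at rm ⊢
      linarith

theorem stmt15 {A : Type*} (ψ : ℕ → A ⊕ ℕ) (hadm : Admissible ψ) (hred : Reduced ψ)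
    (hδ : deltaPsi ψ < ENNReal.ofReal (Real.sqrt 3)) :
    (Sset ψ).Finite ∨
      ∃ K : ℕ, ∀ m n, ConsecIn (Sset ψ) m n → K ≤ n →
        ∃ j : ℕ, ψ n = Sum.inr j ∧ j + 1 = m := by
  by_cases hfin : (Sset ψ).Finite
  · exact Or.inl hfin
  right
  have hinf : (Sset ψ).Infinite := hfin
  have sm := nseq_sm hadm
  set s := Real.sqrt 3 with hsdef
  have hs : s ^ 2 = 3 := Real.sq_sqrt (by norm_num)
  have hs0 : 0 ≤ s := Real.sqrt_nonneg 3
  have h1s : 1 < s := by nlinarith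
  have hs2 : s < 2 := by nlinarith
  have hev := Filter.eventually_lt_of_limsup_lt hδ
  obtain ⟨K1, hK1⟩ := Filter.eventually_atTop.1 hev
  have hlt : ∀ i, K1 + 1 ≤ i → (nseq ψ (i + 1) : ℝ) < s * nseq ψ i := by
    intro i hi
    have h := hK1 i (by omega)
    have hpos : 0 < nseq ψ i := lt_of_le_of_lt (Nat.zero_le _) (sm (show 0 < i by omega))
    rw [ENNReal.div_lt_iff (Or.inl (by exact_mod_cast hpos.ne'))
      (Or.inl (ENNReal.natCast_ne_top _))] at h
    rw [← ENNReal.ofReal_natCast, ← ENNReal.ofReal_natCast, ← ENNReal.ofReal_mul hs0,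
      ENNReal.ofReal_lt_ofReal_iff (by positivity)] at h
    exact h
  have hred' : ∀ m n, ConsecIn (Sset ψ) m n → K1 + 1 ≤ n → ∃ j, ψ n = Sum.inr j ∧ j < m := by
    intro m n hc hn
    rcases (hred m n hc).2 with ⟨a, ha⟩ | h
    · exfalso
      have h1 := hlt n hn
      rw [nseq_succ_inl ha] at h1
      push_cast at h1
      have : (0:ℝ) ≤ nseq ψ n := Nat.cast_nonneg _
      nlinarith
    · exact h
  have hstep : ∀ m n, ConsecIn (Sset ψ) m n → K1 + 1 ≤ n → Cdef ψ n ≤ Cdef ψ m := by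
    intro m n hc hn
    obtain ⟨j, hj, hjm⟩ := hred' m n hc hn
    have := C_step hadm hc hj
    have h2 : nseq ψ j ≤ nseq ψ (m - 1) := sm.monotone (by omega)
    omega
  have hanti : ∀ p ∈ Sset ψ, K1 + 1 ≤ p → ∀ q, q ∈ Sset ψ → p ≤ q → Cdef ψ q ≤ Cdef ψ p := by
    intro p hp hKp q
    induction q using Nat.strong_induction_on with
    | _ q ih =>
      intro hq hpq
      rcases hpq.eq_or_lt with rfl | hlt'
      · exact le_rfl
      · obtain ⟨l, hpl, hc⟩ := exists_pred _ hp hq hlt'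
        exact (hstep l q hc (by omega)).trans (ih l hc.2.2.1 hc.1 hpl)
  by_cases hex : ∃ p ∈ Sset ψ, K1 + 1 ≤ p ∧ Cdef ψ p ≤ 0
  · obtain ⟨p, hp, hKp, hCp⟩ := hex
    obtain ⟨q, hq, hpq⟩ := hinf.exists_gt p
    refine ⟨q + 1, fun m n hc hn => ?_⟩
    have hmq : q ≤ m := by
      by_contra hcon
      exact hc.2.2.2 q hq ⟨by omega, by omega⟩
    obtain ⟨l, hpl, hlm⟩ := exists_pred _ hp hc.1 (by omega : p < m)
    have hCl := hanti p hp hKp l hlm.1 hpl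
    obtain ⟨a, ha, hal⟩ := hred' l m hlm (by omega)
    obtain ⟨b, hb, hbm⟩ := hred' m n hc (by omega)
    exact ⟨b, hb, local_good hadm hs h1s hs2 (by omega) (fun i hi => hlt i (by omega)) hlm hc
      ha hal hb hbm (by omega)⟩
  · push Not at hex
    let T : Set ℕ := {q | q ∈ Sset ψ ∧ K1 + 1 ≤ q}
    have hT : T.Nonempty := by
      obtain ⟨q, hq, h⟩ := hinf.exists_gt (K1 + 1)
      exact ⟨q, hq, h.le⟩
    obtain ⟨q, ⟨hq, hKq⟩, hmin⟩ :
        ∃ q ∈ T, ∀ r ∈ T, (Cdef ψ q).toNat ≤ (Cdef ψ r).toNat := by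
      have := hT.image (fun r => (Cdef ψ r).toNat)
      obtain ⟨q, hq, he⟩ := Nat.sInf_mem this
      refine ⟨q, hq, fun r hr => ?_⟩
      have h2 := Nat.sInf_le (Set.mem_image_of_mem (fun r => (Cdef ψ r).toNat) hr)
      rw [← he] at h2
      exact h2
    refine ⟨q + 1, fun m n hc hn => ?_⟩
    have hmq : q ≤ m := by
      by_contra hcon
      exact hc.2.2.2 q hq ⟨by omega, by omega⟩
    obtain ⟨b, hb, hbm⟩ := hred' m n hc (by omega)
    refine ⟨b, hb, ?_⟩
    by_contra hne
    have h1 := C_step hadm hc hb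
    have h2 : nseq ψ b < nseq ψ (m - 1) := sm (by omega)
    have h3 := hanti q hq hKq m hc.1 hmq
    have h4 := hmin n ⟨hc.2.1, by omega⟩
    have h5 := hex n hc.2.1 (by omega)
    omega
end
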